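/- Let χ₁, χ₂ be primitive Dirichlet characters of conductors q₁, q₂ respectively, with q₁, q₂ > 1, and suppose both χ₁ and χ₂ are odd (χ₁(−1) = χ₂(−1) = −1). Let γ = (a b; c·q₁q₂ d) ∈ Γ₀(q₁q₂) and set γ' = (d −c; −b·q₁q₂ a) ∈ Γ₀(q₁q₂). Then for all z, w in the upper half-plane ℍ, (τ(conj(χ₁))/(πi)) · ( f_{χ₁,χ₂}(γ·z) − (χ₁·conj(χ₂))(d)·f_{χ₁,χ₂}(z) ) = −(τ(conj(χ₂))/(πi)) · ( f_{χ₂,χ₁}(γ'·w) − (χ₂·conj(χ₁))(a)·f_{χ₂,χ₁}(w) ) + (1 − (χ₁·conj(χ₂))(d)) · (τ(conj(χ₁))·τ(conj(χ₂))/(πi)²) · L(1,χ₁)·L(1,χ₂). -/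

import Mathlib

open Complex

/-- `e(w) = exp(2πiw)`. -/
noncomputable def eC (w : ℂ) : ℂ := Complex.exp (2 * Real.pi * Complex.I * w)

/-- The holomorphic part `f_{χ₁,χ₂}(z) = ∑_{l≥1} ∑_{k≥1} (χ₁(l) conj(χ₂)(k) / l) e(klz)`. -/
noncomputable def fE {q₁ q₂ : ℕ} (χ₁ : DirichletCharacter ℂ q₁)
    (χ₂ : DirichletCharacter ℂ q₂) (z : ℂ) : ℂ :=
  ∑' l : ℕ+, ∑' k : ℕ+,
    χ₁ ((l : ℕ) : ZMod q₁) * (starRingEnd ℂ) (χ₂ ((k : ℕ) : ZMod q₂)) / (l : ℂ)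
      * eC ((k : ℂ) * (l : ℂ) * z)

/-- The Gauss sum `τ(χ) = ∑_{n mod q} χ(n) e(n/q)`. -/
noncomputable def gaussSum' {q : ℕ} (χ : DirichletCharacter ℂ q) : ℂ :=
  ∑ n ∈ Finset.range q, χ ((n : ℕ) : ZMod q) * eC ((n : ℂ) / (q : ℂ))

/-- The first Bernoulli function, `B₁(x) = x - ⌊x⌋ - 1/2` off ℤ, and `0` on ℤ. -/
noncomputable def B1 (x : ℝ) : ℝ := if Int.fract x = 0 then 0 else Int.fract x - 1 / 2

open Filter Topology

lemma conj_comp_eq_inv {q : ℕ} [NeZero q] (χ : DirichletCharacter ℂ q) :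
    χ.ringHomComp (starRingEnd ℂ) = χ⁻¹ := by
  exact MulChar.star_eq_inv χ

lemma conj_apply_eq_inv {q : ℕ} [NeZero q] (χ : DirichletCharacter ℂ q) (x : ZMod q) :
    (starRingEnd ℂ) (χ x) = χ⁻¹ x := by
  rw [← conj_comp_eq_inv]; rfl

lemma sum_range_zmod {q : ℕ} [NeZero q] (f : ZMod q → ℂ) :
    ∑ n ∈ Finset.range q, f ((n : ℕ) : ZMod q) = ∑ x : ZMod q, f x := by
  refine Finset.sum_bij' (fun n _ => ((n : ℕ) : ZMod q)) (fun x _ => x.val) ?_ ?_ ?_ ?_ ?_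
  · simp
  · intro x _; simpa using ZMod.val_lt x
  · intro n hn; exact ZMod.val_cast_of_lt (by simpa using hn)
  · intro x _; simp
  · simp

lemma gaussSum'_eq {q : ℕ} [NeZero q] (χ : DirichletCharacter ℂ q) :
    gaussSum' χ = gaussSum χ ZMod.stdAddChar := by
  unfold gaussSum' gaussSum
  rw [← sum_range_zmod (fun x => χ x * ZMod.stdAddChar x)]
  refine Finset.sum_congr rfl fun n _ => ?_
  have := ZMod.stdAddChar_coe (N := q) (n : ℤ)
  simp only [Int.cast_natCast] at this
  rw [this, eC]; congr 2; ring

/-- Twisted Gauss sum. -/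
lemma gauss_twist {q : ℕ} [NeZero q] {χ : DirichletCharacter ℂ q} (hχ : χ.IsPrimitive) (k : ℕ) :
    ∑ n ∈ Finset.range q, χ ((n : ℕ) : ZMod q) * eC ((k : ℂ) * ((n : ℂ) / (q : ℂ)))
      = χ⁻¹ ((k : ℕ) : ZMod q) * gaussSum' χ := by
  rw [gaussSum'_eq, ← gaussSum_mulShift_of_isPrimitive _ hχ, gaussSum,
    ← sum_range_zmod (fun x => χ x * (ZMod.stdAddChar.mulShift (k : ZMod q)) x)]
  refine Finset.sum_congr rfl fun n _ => ?_
  have := ZMod.stdAddChar_coe (N := q) ((k * n : ℕ) : ℤ)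
  rw [AddChar.mulShift_apply, ← Nat.cast_mul]
  simp only [Int.cast_natCast] at this
  rw [this, eC]; congr 2; push_cast; ring

lemma inv_primitive {q : ℕ} [NeZero q] {χ : DirichletCharacter ℂ q} (hχ : χ.IsPrimitive) :
    (χ⁻¹).IsPrimitive := by
  have key : ∀ ψ : DirichletCharacter ℂ q, ψ.conductorSet ⊆ (ψ⁻¹).conductorSet := by
    rintro ψ d ⟨hd, χ₀, h⟩
    exact ⟨hd, χ₀⁻¹, by rw [h, map_inv]⟩
  have : (χ⁻¹).conductorSet = χ.conductorSet :=
    Set.Subset.antisymm (by simpa using key χ⁻¹) (key χ)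
  unfold DirichletCharacter.IsPrimitive DirichletCharacter.conductor at *
  rw [this, hχ]

open ZMod in
lemma gauss_mul_gauss {q : ℕ} [NeZero q] {χ : DirichletCharacter ℂ q} (hχ : χ.IsPrimitive)
    (hodd : χ (-1) = -1) : gaussSum' χ * gaussSum' χ⁻¹ = -q := by
  have h1 := congrFun (ZMod.dft_dft (χ : ZMod q → ℂ)) 1
  have h2 : 𝓕 (χ : ZMod q → ℂ) = fun k => gaussSum χ ZMod.stdAddChar * (- χ⁻¹ k) := by
    ext k
    rw [hχ.fourierTransform_eq_inv_mul_gaussSum, ← neg_one_mul, map_mul]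
    have : χ⁻¹ (-1) = -1 := by rw [← conj_apply_eq_inv, hodd]; simp
    rw [this]; ring
  have hinv : χ⁻¹ (-1) = -1 := by rw [← conj_apply_eq_inv, hodd]; simp
  have h3 : 𝓕 (fun k => χ⁻¹ k) 1 = _ := (inv_primitive hχ).fourierTransform_eq_inv_mul_gaussSum 1
  have h4 : 𝓕 (fun k => gaussSum χ ZMod.stdAddChar * (- χ⁻¹ k)) 1 = - (gaussSum χ ZMod.stdAddChar) * 𝓕 (fun k => χ⁻¹ k) 1 := by
    simp only [ZMod.dft_apply, Finset.mul_sum, smul_eq_mul]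
    refine Finset.sum_congr rfl fun n _ => ?_
    ring
  rw [h2, h4, h3] at h1
  rw [inv_inv, hodd, smul_eq_mul] at h1
  rw [gaussSum'_eq, gaussSum'_eq]
  linear_combination h1

lemma gauss_ne_zero {q : ℕ} [NeZero q] {χ : DirichletCharacter ℂ q} (hχ : χ.IsPrimitive)
    (hodd : χ (-1) = -1) : gaussSum' χ ≠ 0 := by
  intro h
  have := gauss_mul_gauss hχ hodd
  rw [h, zero_mul] at this
  exact NeZero.ne (q : ℂ) (by linear_combination this)

lemma odd_ne_one {q : ℕ} {χ : DirichletCharacter ℂ q} (hodd : χ (-1) = -1) : χ ≠ 1 := by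
  rintro rfl
  rw [MulChar.one_apply (by simp)] at hodd
  norm_num at hodd

lemma sum_char_range {q : ℕ} [NeZero q] {χ : DirichletCharacter ℂ q} (hodd : χ (-1) = -1) :
    ∑ n ∈ Finset.range q, χ ((n : ℕ) : ZMod q) = 0 := by
  rw [sum_range_zmod (fun x => χ x)]
  exact MulChar.sum_eq_zero_of_ne_one (odd_ne_one hodd)

set_option linter.unusedSectionVars false
open Complex
open Filter Topology

noncomputable def Kr (ε : ℝ) (w : ℂ) : ℂ := (w ^ 2)⁻¹ * ((1 + ε * ‖w‖ ^ 2 : ℝ) : ℂ)⁻¹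

lemma Kr_diff {ε : ℝ} (hε : 0 ≤ ε) {w w' : ℂ} (hw : w ≠ 0) (hw' : w' ≠ 0) :
    ‖Kr ε w - Kr ε w'‖ ≤ 2 * ‖w' - w‖ * (‖w‖ + ‖w'‖) / (‖w‖ ^ 2 * ‖w'‖ ^ 2) := by
  have hA : 0 < ‖w‖ := norm_pos_iff.mpr hw
  have hA' : 0 < ‖w'‖ := norm_pos_iff.mpr hw'
  set A := ‖w‖ with hAd
  set A' := ‖w'‖ with hAd'
  have hsub : |A' - A| ≤ ‖w' - w‖ := abs_norm_sub_norm_le _ _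
  have e1 : Kr ε w - Kr ε w' = ((w ^ 2)⁻¹ - (w' ^ 2)⁻¹) * (((1 + ε * A ^ 2)⁻¹ : ℝ) : ℂ)
      + (w' ^ 2)⁻¹ * (((1 + ε * A ^ 2)⁻¹ - (1 + ε * A' ^ 2)⁻¹ : ℝ) : ℂ) := by
    simp only [Kr, ← hAd, ← hAd']; push_cast; ring
  have b1 : ‖(w ^ 2)⁻¹ - (w' ^ 2)⁻¹‖ ≤ ‖w' - w‖ * (A + A') / (A ^ 2 * A' ^ 2) := by
    have : (w ^ 2)⁻¹ - (w' ^ 2)⁻¹ = (w' - w) * (w + w') / (w ^ 2 * w' ^ 2) := by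
      field_simp; ring
    rw [this, norm_div, norm_mul, norm_mul, norm_pow, norm_pow]
    gcongr
    exact norm_add_le _ _
  have hp : 1 ≤ 1 + ε * A ^ 2 := by nlinarith [mul_nonneg hε (sq_nonneg A)]
  have hp' : 1 ≤ 1 + ε * A' ^ 2 := by nlinarith [mul_nonneg hε (sq_nonneg A')]
  have b2 : |(1 + ε * A ^ 2)⁻¹| ≤ 1 := by
    rw [abs_of_nonneg (by positivity)]
    exact inv_le_one_of_one_le₀ hp
  have b3 : |(1 + ε * A ^ 2)⁻¹ - (1 + ε * A' ^ 2)⁻¹| ≤ ‖w' - w‖ * (A + A') / A ^ 2 := by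
    have : (1 + ε * A ^ 2)⁻¹ - (1 + ε * A' ^ 2)⁻¹
        = ((A' - A) * (A + A')) * (ε / ((1 + ε * A ^ 2) * (1 + ε * A' ^ 2))) := by
      field_simp; ring
    rw [this, abs_mul, abs_mul, abs_of_pos (by positivity : 0 < A + A'),
      abs_of_nonneg (by positivity : 0 ≤ (ε / ((1 + ε * A ^ 2) * (1 + ε * A' ^ 2))))]
    rw [div_eq_mul_inv (‖w' - w‖ * (A + A'))]
    gcongr
    rw [inv_eq_one_div, div_le_div_iff₀ (by positivity) (by positivity)]
    nlinarith [mul_nonneg hε (sq_nonneg A), mul_nonneg hε (sq_nonneg A'),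
      mul_nonneg (mul_nonneg hε (sq_nonneg A)) (mul_nonneg hε (sq_nonneg A'))]
  rw [e1]
  refine (norm_add_le _ _).trans ?_
  have hn : ‖(w' ^ 2)⁻¹‖ = (A' ^ 2)⁻¹ := by rw [norm_inv, norm_pow]
  rw [norm_mul, norm_mul, Complex.norm_real, Complex.norm_real, hn,
    Real.norm_eq_abs, Real.norm_eq_abs]
  have h1 := mul_le_mul b1 b2 (abs_nonneg _) (by positivity)
  have h2 := mul_le_mul_of_nonneg_left b3 (by positivity : 0 ≤ (A' ^ 2)⁻¹)
  refine (add_le_add h1 h2).trans (le_of_eq ?_)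
  field_simp; ring

lemma Kr_norm_le {ε : ℝ} (hε : 0 < ε) (w : ℂ) : ‖Kr ε w‖ ≤ ε⁻¹ * (‖w‖ ^ 4)⁻¹ := by
  rcases eq_or_ne w 0 with rfl | hw
  · simp [Kr]
  have hA : 0 < ‖w‖ := norm_pos_iff.mpr hw
  rw [Kr, norm_mul, norm_inv, norm_inv, Complex.norm_real, norm_pow, Real.norm_eq_abs,
    abs_of_nonneg (by positivity), ← mul_inv, ← mul_inv]
  apply inv_anti₀ (by positivity)
  nlinarith [sq_nonneg ‖w‖]

lemma Kr_scale (ε : ℝ) (c w : ℂ) : Kr ε (c * w) = (c ^ 2)⁻¹ * Kr (ε * ‖c‖ ^ 2) w := by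
  simp only [Kr, norm_mul, mul_pow, mul_inv]
  push_cast
  ring_nf

lemma Kr_neg (ε : ℝ) (w : ℂ) : Kr ε (-w) = Kr ε w := by
  simp [Kr]

lemma Kr_tendsto (w : ℂ) : Tendsto (fun ε => Kr ε w) (𝓝[>] (0:ℝ)) (𝓝 (Kr 0 w)) := by
  have : ContinuousAt (fun ε => Kr ε w) 0 := by
    unfold Kr
    refine ContinuousAt.mul continuousAt_const (ContinuousAt.inv₀ ?_ ?_)
    · fun_prop
    · simp
  exact this.tendsto.mono_left nhdsWithin_le_nhds

lemma summ_pow (k : ℕ) (hk : 3 ≤ k) (z : ℂ) (hz : 0 < z.im) :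
    Summable fun p : ℤ × ℤ => (‖(p.1 : ℂ) * z + p.2‖ ^ k)⁻¹ := by
  have h := EisensteinSeries.summable_norm_eisSummand (k := (k : ℤ)) (by exact_mod_cast hk) ⟨z, hz⟩
  rw [← (finTwoArrowEquiv ℤ).symm.summable_iff] at h
  refine h.congr fun p => ?_
  simp [EisensteinSeries.eisSummand]

section
variable {q₁ q₂ : ℕ} [NeZero q₁] [NeZero q₂] (χ₁ : DirichletCharacter ℂ q₁)
    (χ₂ : DirichletCharacter ℂ q₂)

noncomputable def Tt (ε : ℝ) (x y : ℂ) : ℂ :=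
  ∑' p : ℤ × ℤ, χ₁ (p.1 : ZMod q₁) * χ₂ (p.2 : ZMod q₂) * Kr ε (p.1 * x + p.2 * y)

noncomputable def Bl (z : ℂ) (ε : ℝ) (p : ℤ × ℤ) : ℂ :=
  χ₁ (p.1 : ZMod q₁) * ∑ v ∈ Finset.range q₂, χ₂ ((v : ℕ) : ZMod q₂) *
    Kr ε (q₂ * (p.1 * z + p.2) + v)

lemma Tt_summable {ε : ℝ} (hε : 0 < ε) {z : ℂ} (hz : 0 < z.im) :
    Summable fun p : ℤ × ℤ => χ₁ (p.1 : ZMod q₁) * χ₂ (p.2 : ZMod q₂) * Kr ε (p.1 * z + p.2) := by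
  refine Summable.of_norm_bounded ((summ_pow 4 (by norm_num) z hz).mul_left ε⁻¹) fun p => ?_
  rw [norm_mul, norm_mul]
  calc _ ≤ 1 * 1 * ‖Kr ε (p.1 * z + p.2)‖ := by
        gcongr
        · exact DirichletCharacter.norm_le_one _ _
        · exact DirichletCharacter.norm_le_one _ _
    _ ≤ _ := by rw [one_mul, one_mul]; exact Kr_norm_le hε _

def splitEquiv (q : ℕ) [NeZero q] : ℤ × ℤ ≃ (ℤ × ℤ) × Fin q :=
  ((Equiv.refl ℤ).prodCongr (Int.divModEquiv q)).trans (Equiv.prodAssoc ℤ ℤ (Fin q)).symm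

lemma Tt_eq_Bl {ε : ℝ} (hε : 0 < ε) {z : ℂ} (hz : 0 < z.im) :
    Tt χ₁ χ₂ ε (q₂ * z) 1 = ∑' p, Bl χ₁ χ₂ z ε p := by
  have hz' : 0 < ((q₂ : ℂ) * z).im := by
    have : (0:ℝ) < q₂ := by exact_mod_cast Nat.pos_of_ne_zero (NeZero.ne q₂)
    simpa using mul_pos this hz
  have hs := Tt_summable χ₁ χ₂ hε hz'
  unfold Tt
  simp only [mul_one]
  rw [← (splitEquiv q₂).symm.tsum_eq, Summable.tsum_prod]
  · refine tsum_congr fun p => ?_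
    rw [tsum_fintype, Bl, Finset.mul_sum, ← Fin.sum_univ_eq_sum_range (fun v =>
      χ₁ (p.1 : ZMod q₁) * (χ₂ ((v : ℕ) : ZMod q₂) * Kr ε (q₂ * (p.1 * z + p.2) + v)))]
    refine Finset.sum_congr rfl fun v _ => ?_
    simp [splitEquiv]
    rw [mul_assoc]
    congr 3
    ring
  · exact hs.comp_injective (splitEquiv q₂).symm.injective

lemma Bl_bound (hq₁ : 1 < q₁) (hodd₂ : χ₂ (-1) = -1) {z : ℂ} (hz : 0 < z.im) :
    ∃ C : ℝ, ∀ ε : ℝ, 0 ≤ ε → ∀ p, ‖Bl χ₁ χ₂ z ε p‖ ≤ C * (‖(p.1 : ℂ) * z + p.2‖ ^ 3)⁻¹ := by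
  set κ : ℝ := 1 + q₂ / z.im with hκ
  have hκ1 : 1 ≤ κ := by rw [hκ]; have : 0 ≤ (q₂:ℝ) / z.im := by positivity
                         linarith
  refine ⟨∑ v ∈ Finset.range q₂, 2 * q₂ * ((1 + κ) * κ ^ 2), fun ε hε p => ?_⟩
  obtain ⟨l, n⟩ := p
  have hq : (1:ℝ) ≤ q₂ := by exact_mod_cast Nat.pos_of_ne_zero (NeZero.ne q₂)
  have hC : 0 ≤ ∑ v ∈ Finset.range q₂, 2 * (q₂ : ℝ) * ((1 + κ) * κ ^ 2) := by positivity
  dsimp only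
  rcases eq_or_ne l 0 with rfl | hl
  · have : χ₁ ((0 : ℤ) : ZMod q₁) = 0 := by
      rw [Int.cast_zero]; exact χ₁.map_zero' hq₁.ne'
    rw [Bl]; dsimp only
    rw [this, zero_mul, norm_zero]; positivity
  · set w₀ : ℂ := (l : ℂ) * z + n with hw₀
    set w : ℂ := q₂ * w₀ with hw
    have him : ∀ v : ℕ, z.im ≤ ‖w + v‖ := by
      intro v
      have h1 : (w + v).im = q₂ * (l * z.im) := by simp [hw, hw₀]
      refine le_trans ?_ (Complex.abs_im_le_norm _)
      rw [h1, abs_mul, abs_mul, abs_of_pos hz, abs_of_pos (by linarith : (0:ℝ) < q₂)]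
      have : (1:ℝ) ≤ |(l:ℝ)| := by exact_mod_cast Int.one_le_abs hl
      nlinarith [mul_le_mul hq this (by norm_num) (by linarith)]
    have hA0 : z.im ≤ ‖w‖ := by simpa using him 0
    have hApos : 0 < ‖w‖ := hz.trans_le hA0
    have hw0pos : 0 < ‖w₀‖ := by
      rw [hw, norm_mul] at hApos
      exact pos_of_mul_pos_right hApos (norm_nonneg _)
    have hww : ‖w‖ = q₂ * ‖w₀‖ := by rw [hw, norm_mul]; simp
    have e1 : ∑ v ∈ Finset.range q₂, χ₂ ((v : ℕ) : ZMod q₂) * Kr ε (w + v)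
        = ∑ v ∈ Finset.range q₂, χ₂ ((v : ℕ) : ZMod q₂) * (Kr ε (w + v) - Kr ε w) := by
      simp only [mul_sub, Finset.sum_sub_distrib]
      rw [← Finset.sum_mul, sum_char_range hodd₂]; simp
    rw [Bl]; dsimp only
    rw [← hw₀, ← hw, e1, norm_mul]
    refine (mul_le_mul_of_nonneg_right (DirichletCharacter.norm_le_one _ _) (norm_nonneg _)).trans ?_
    rw [one_mul, Finset.sum_mul]
    refine norm_sum_le_of_le _ fun v hv => ?_
    have hvq : (v : ℝ) ≤ q₂ := by exact_mod_cast (Finset.mem_range.mp hv).le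
    rw [norm_mul]
    refine (mul_le_mul_of_nonneg_right (DirichletCharacter.norm_le_one _ _) (norm_nonneg _)).trans ?_
    rw [one_mul]
    have hA'pos : 0 < ‖w + v‖ := hz.trans_le (him v)
    refine (Kr_diff hε (norm_pos_iff.mp hA'pos) (norm_pos_iff.mp hApos)).trans ?_
    have hd : ‖w - (w + v)‖ = v := by simp
    rw [hd]
    have k1 : ‖w‖ ≤ κ * ‖w + v‖ := by
      have : ‖w‖ ≤ ‖w + v‖ + v := by
        have := norm_sub_le (w + v) (v : ℂ)
        simpa using this
      have h2 : (q₂ : ℝ) ≤ q₂ / z.im * ‖w + v‖ := by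
        rw [div_mul_eq_mul_div, le_div_iff₀ hz]
        exact mul_le_mul_of_nonneg_left (him v) (by linarith)
      rw [hκ]; linarith
    have k2 : ‖w + v‖ ≤ κ * ‖w‖ := by
      have : ‖w + v‖ ≤ ‖w‖ + v := by
        have := norm_add_le w (v : ℂ)
        simpa using this
      have h2 : (q₂ : ℝ) ≤ q₂ / z.im * ‖w‖ := by
        rw [div_mul_eq_mul_div, le_div_iff₀ hz]
        exact mul_le_mul_of_nonneg_left hA0 (by linarith)
      rw [hκ]; linarith
    have k3 : ‖w₀‖ ≤ ‖w‖ := by rw [hww]; nlinarith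
    have k1s : ‖w‖ ^ 2 ≤ κ ^ 2 * ‖w + v‖ ^ 2 := by
      rw [← mul_pow]; exact pow_le_pow_left₀ hApos.le k1 2
    calc 2 * (v:ℝ) * (‖w + v‖ + ‖w‖) / (‖w + v‖ ^ 2 * ‖w‖ ^ 2)
        ≤ 2 * q₂ * ((1 + κ) * κ ^ 2) * (‖w‖ ^ 3)⁻¹ := by
          rw [← div_eq_mul_inv, div_le_div_iff₀ (by positivity) (by positivity)]
          calc 2 * (v:ℝ) * (‖w + v‖ + ‖w‖) * ‖w‖ ^ 3
              ≤ 2 * q₂ * (κ * ‖w‖ + ‖w‖) * ‖w‖ ^ 3 := by gcongr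
            _ = 2 * q₂ * (1 + κ) * ‖w‖ ^ 2 * ‖w‖ ^ 2 := by ring
            _ ≤ 2 * q₂ * (1 + κ) * ‖w‖ ^ 2 * (κ ^ 2 * ‖w + v‖ ^ 2) := by gcongr
            _ = _ := by ring
      _ ≤ _ := by gcongr

lemma Bl_summable (hq₁ : 1 < q₁) (hodd₂ : χ₂ (-1) = -1) {z : ℂ} (hz : 0 < z.im) :
    Summable (Bl χ₁ χ₂ z 0) := by
  obtain ⟨C, hC⟩ := Bl_bound χ₁ χ₂ hq₁ hodd₂ hz
  exact Summable.of_norm_bounded ((summ_pow 3 le_rfl z hz).mul_left C) (hC 0 le_rfl)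

lemma Tt_tendsto (hq₁ : 1 < q₁) (hodd₂ : χ₂ (-1) = -1) {z : ℂ} (hz : 0 < z.im) :
    Tendsto (fun ε => Tt χ₁ χ₂ ε (q₂ * z) 1) (𝓝[>] (0:ℝ)) (𝓝 (∑' p, Bl χ₁ χ₂ z 0 p)) := by
  obtain ⟨C, hC⟩ := Bl_bound χ₁ χ₂ hq₁ hodd₂ hz
  have h := tendsto_tsum_of_dominated_convergence (𝓕 := 𝓝[>] (0:ℝ)) (f := fun ε p => Bl χ₁ χ₂ z ε p)
    (g := Bl χ₁ χ₂ z 0) ((summ_pow 3 le_rfl z hz).mul_left C) ?_ ?_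
  · refine h.congr' ?_
    filter_upwards [self_mem_nhdsWithin] with ε hε
    exact (Tt_eq_Bl χ₁ χ₂ hε hz).symm
  · intro p
    unfold Bl
    exact (tendsto_finsetSum _ fun v _ => (Kr_tendsto _).const_mul _).const_mul _
  · filter_upwards [self_mem_nhdsWithin] with ε hε
    exact hC ε (le_of_lt hε)
end

set_option linter.unusedSectionVars false
open Complex
open Filter Topology

section
variable {q₁ q₂ : ℕ} [NeZero q₁] [NeZero q₂] (χ₁ : DirichletCharacter ℂ q₁)
    (χ₂ : DirichletCharacter ℂ q₂)

lemma Tt_scale (ε : ℝ) (c x y : ℂ) :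
    Tt χ₁ χ₂ ε (c * x) (c * y) = (c ^ 2)⁻¹ * Tt χ₁ χ₂ (ε * ‖c‖ ^ 2) x y := by
  unfold Tt
  rw [← tsum_mul_left]
  refine tsum_congr fun p => ?_
  rw [show (p.1 : ℂ) * (c * x) + p.2 * (c * y) = c * (p.1 * x + p.2 * y) by ring, Kr_scale]
  ring

lemma Tt_swap (ε : ℝ) (x y : ℂ) : Tt χ₁ χ₂ ε x y = Tt χ₂ χ₁ ε y x := by
  unfold Tt
  rw [← (Equiv.prodComm ℤ ℤ).tsum_eq]
  refine tsum_congr fun p => ?_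
  simp only [Equiv.prodComm_apply, Prod.fst_swap, Prod.snd_swap]
  rw [add_comm, mul_comm (χ₁ _)]

lemma Tt_neg (hodd₁ : χ₁ (-1) = -1) (ε : ℝ) (x y : ℂ) :
    Tt χ₁ χ₂ ε (-x) y = - Tt χ₁ χ₂ ε x y := by
  unfold Tt
  rw [← ((Equiv.neg ℤ).prodCongr (Equiv.refl ℤ)).tsum_eq, ← tsum_neg]
  refine tsum_congr fun p => ?_
  have : χ₁ (-(p.1 : ZMod q₁)) = - χ₁ p.1 := by
    rw [← neg_one_mul, map_mul, hodd₁]; ring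
  simp [this]

def matEquiv (a b c d : ℤ) (h : a * d - b * c = 1) : ℤ × ℤ ≃ ℤ × ℤ where
  toFun p := (p.1 * a + p.2 * c, p.1 * b + p.2 * d)
  invFun p := (p.1 * d - p.2 * c, - p.1 * b + p.2 * a)
  left_inv p := by
    ext
    · dsimp only; linear_combination p.1 * h
    · dsimp only; linear_combination p.2 * h
  right_inv p := by
    ext
    · dsimp only; linear_combination p.1 * h
    · dsimp only; linear_combination p.2 * h

lemma Tt_mat (a b c d : ℤ) (h : a * d - (b * q₂) * (c * q₁) = 1) (ε : ℝ) (x y : ℂ) :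
    χ₁ (a : ZMod q₁) * χ₂ (d : ZMod q₂) *
      Tt χ₁ χ₂ ε (a * x + (b * q₂) * y) ((c * q₁) * x + d * y) = Tt χ₁ χ₂ ε x y := by
  unfold Tt
  rw [← (matEquiv a (b * q₂) (c * q₁) d h).tsum_eq
    (fun p : ℤ × ℤ => χ₁ (p.1 : ZMod q₁) * χ₂ (p.2 : ZMod q₂) * Kr ε (p.1 * x + p.2 * y)),
    ← tsum_mul_left]
  refine tsum_congr fun p => ?_
  have e1 : ((p.1 * a + p.2 * (c * q₁) : ℤ) : ZMod q₁) = p.1 * a := by simp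
  have e2 : ((p.1 * (b * q₂) + p.2 * d : ℤ) : ZMod q₂) = p.2 * d := by simp
  simp only [matEquiv, Equiv.coe_fn_mk]
  rw [e1, e2, map_mul, map_mul]
  rw [show (p.1 : ℂ) * (a * x + (b * q₂) * y) + p.2 * ((c * q₁) * x + d * y)
    = ((p.1 * a + p.2 * (c * q₁) : ℤ) : ℂ) * x + ((p.1 * (b * q₂) + p.2 * d : ℤ) : ℂ) * y by
      push_cast; ring]
  ring

lemma tendsto_scale {c : ℂ} (hc : c ≠ 0) :
    Tendsto (fun ε : ℝ => ε * ‖c‖ ^ 2) (𝓝[>] 0) (𝓝[>] 0) := by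
  have hc' : 0 < ‖c‖ ^ 2 := by have := norm_pos_iff.mpr hc; positivity
  refine tendsto_nhdsWithin_iff.mpr ⟨?_, ?_⟩
  · have : ContinuousAt (fun ε : ℝ => ε * ‖c‖ ^ 2) 0 := by fun_prop
    have := this.tendsto
    simp only [zero_mul] at this
    exact this.mono_left nhdsWithin_le_nhds
  · filter_upwards [self_mem_nhdsWithin] with ε hε
    exact mul_pos hε hc'

noncomputable def Sd (z : ℂ) : ℂ := ∑' p, Bl χ₁ χ₂ z 0 p

lemma den_ne {c d : ℤ} (h : c ≠ 0 ∨ d ≠ 0) {z : ℂ} (hz : 0 < z.im) : (c : ℂ) * z + d ≠ 0 := by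
  intro h0
  have him := congrArg Complex.im h0
  have hre := congrArg Complex.re h0
  simp at him hre
  rcases him with h1 | h1
  · subst h1
    simp at hre
    tauto
  · exact hz.ne' h1

lemma moeb_im {a b c d : ℤ} (h : a * d - b * c = 1) {z : ℂ} (hz : 0 < z.im) :
    0 < (((a : ℂ) * z + b) / ((c : ℂ) * z + d)).im := by
  have hne : (c : ℂ) * z + d ≠ 0 := by
    apply den_ne _ hz
    by_contra hh
    push Not at hh
    rw [hh.1, hh.2] at h
    simp at h
  have hn : 0 < Complex.normSq ((c : ℂ) * z + d) := Complex.normSq_pos.mpr hne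
  have e : (((a : ℂ) * z + b) / ((c : ℂ) * z + d)).im = z.im / Complex.normSq ((c : ℂ) * z + d) := by
    rw [Complex.div_im]
    have h' : (a : ℝ) * d - b * c = 1 := by exact_mod_cast h
    simp
    field_simp
    linear_combination h'
  rw [e]; positivity

lemma Sd_mod (hq₁ : 1 < q₁) (hodd₂ : χ₂ (-1) = -1) (a b c d : ℤ)
    (h : a * d - b * (c * (q₁ * q₂ : ℕ)) = 1) {z : ℂ} (hz : 0 < z.im) :
    χ₁ (a : ZMod q₁) * χ₂ (d : ZMod q₂) *
      (((((c * (q₁ * q₂ : ℕ) : ℤ) : ℂ) * z + d) ^ 2)⁻¹ *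
      Sd χ₁ χ₂ ((a * z + b) / (((c * (q₁ * q₂ : ℕ) : ℤ) : ℂ) * z + d))) = Sd χ₁ χ₂ z := by
  set j : ℂ := ((c * (q₁ * q₂ : ℕ) : ℤ) : ℂ) * z + d with hj
  have hne : j ≠ 0 := by
    apply den_ne _ hz
    by_contra hh
    push Not at hh
    rw [hh.1, hh.2] at h
    simp at h
  have hγ := moeb_im h hz
  rw [← hj] at hγ
  have h1 := (Tt_tendsto χ₁ χ₂ hq₁ hodd₂ hγ).comp (tendsto_scale hne)
  have h2 := (h1.const_mul ((j ^ 2)⁻¹)).const_mul (χ₁ (a : ZMod q₁) * χ₂ (d : ZMod q₂))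
  refine tendsto_nhds_unique h2 ((Tt_tendsto χ₁ χ₂ hq₁ hodd₂ hz).congr fun ε => ?_)
  simp only [Function.comp_apply]
  rw [← Tt_scale, ← Tt_mat χ₁ χ₂ a b c d (by rw [← h]; push_cast; ring)]
  congr 2
  · field_simp
  · rw [hj]; push_cast; ring

lemma Sd_fricke (hq₁ : 1 < q₁) (hq₂ : 1 < q₂) (hodd₁ : χ₁ (-1) = -1) (hodd₂ : χ₂ (-1) = -1)
    {z : ℂ} (hz : 0 < z.im) (hw : 0 < (-1 / ((q₁ : ℂ) * q₂ * z)).im) :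
    Sd χ₂ χ₁ (-1 / ((q₁ : ℂ) * q₂ * z)) = - (q₂ * z) ^ 2 * Sd χ₁ χ₂ z := by
  have hz0 : z ≠ 0 := by rintro rfl; simp at hz
  have hq1' : (q₁ : ℂ) ≠ 0 := NeZero.ne _
  have hq2' : (q₂ : ℂ) ≠ 0 := NeZero.ne _
  have hne : ((q₂ : ℂ) * z)⁻¹ ≠ 0 := inv_ne_zero (mul_ne_zero hq2' hz0)
  have h1 := (Tt_tendsto χ₁ χ₂ hq₁ hodd₂ hz).comp (tendsto_scale hne)
  have h2 := h1.const_mul (- (q₂ * z) ^ 2)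
  refine tendsto_nhds_unique (Tt_tendsto χ₂ χ₁ hq₂ hodd₁ hw) (h2.congr fun ε => ?_)
  simp only [Function.comp_apply]
  rw [show (q₁ : ℂ) * (-1 / ((q₁ : ℂ) * q₂ * z)) = ((q₂ : ℂ) * z)⁻¹ * (-1) by field_simp]
  have e : Tt χ₂ χ₁ ε (((q₂ : ℂ) * z)⁻¹ * (-1)) 1
      = Tt χ₂ χ₁ ε (((q₂ : ℂ) * z)⁻¹ * (-1)) (((q₂ : ℂ) * z)⁻¹ * (q₂ * z)) := by
    rw [inv_mul_cancel₀ (mul_ne_zero hq2' hz0)]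
  rw [e, Tt_scale, Tt_neg _ _ hodd₂, Tt_swap χ₂ χ₁]
  rw [inv_pow, inv_inv]; ring
end

set_option linter.unusedSectionVars false
open Complex
open Filter Topology

section
variable {q₁ q₂ : ℕ} [NeZero q₁] [NeZero q₂] (χ₁ : DirichletCharacter ℂ q₁)
    (χ₂ : DirichletCharacter ℂ q₂)

noncomputable def Es (z : ℂ) : ℂ :=
  ∑' l : ℕ+, ∑' k : ℕ+, χ₁ ((l : ℕ) : ZMod q₁) * χ₂⁻¹ ((k : ℕ) : ZMod q₂) * k
      * eC ((k : ℂ) * (l : ℂ) * z)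

lemma eC_natmul (k : ℕ) (w : ℂ) : eC w ^ k = eC (k * w) := by
  rw [eC, eC, ← Complex.exp_nat_mul]; congr 1; ring

lemma eC_add (v w : ℂ) : eC (v + w) = eC v * eC w := by
  rw [eC, eC, eC, ← Complex.exp_add]; congr 1; ring

lemma norm_eC (w : ℂ) : ‖eC w‖ = Real.exp (-2 * Real.pi * w.im) := by
  rw [eC, Complex.norm_exp]; congr 1; simp

lemma norm_eC_lt_one {w : ℂ} (hw : 0 < w.im) : ‖eC w‖ < 1 := by
  rw [norm_eC, Real.exp_lt_one_iff]
  nlinarith [Real.pi_pos, mul_pos Real.pi_pos hw]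

lemma Kr_zero (w : ℂ) : Kr 0 w = (w ^ 2)⁻¹ := by simp [Kr]

lemma summable_inv_sq (x : ℂ) : Summable fun n : ℤ => ((x + n) ^ 2)⁻¹ := by
  have := EisensteinSeries.linear_right_summable x 1 (k := 2) le_rfl
  refine this.congr fun n => ?_
  simp

lemma psi_eq (x : ℂ) :
    ∑' n : ℤ, ∑ v ∈ Finset.range q₂, χ₂ ((v : ℕ) : ZMod q₂) * Kr 0 (q₂ * (x + n) + v)
      = ∑' m : ℤ, χ₂ (m : ZMod q₂) * Kr 0 (q₂ * x + m) := by
  have hs : Summable fun m : ℤ => χ₂ (m : ZMod q₂) * Kr 0 (q₂ * x + m) := by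
    refine Summable.of_norm_bounded (summable_inv_sq (q₂ * x)).norm fun m => ?_
    rw [Kr_zero, norm_mul]
    exact mul_le_of_le_one_left (norm_nonneg _) (DirichletCharacter.norm_le_one _ _)
  rw [← (Int.divModEquiv q₂).symm.tsum_eq (fun m : ℤ => χ₂ (m : ZMod q₂) * Kr 0 (q₂ * x + m)), Summable.tsum_prod]
  · refine tsum_congr fun n => ?_
    rw [tsum_fintype, ← Fin.sum_univ_eq_sum_range (fun v =>
      χ₂ ((v : ℕ) : ZMod q₂) * Kr 0 (q₂ * (x + n) + v))]
    refine Finset.sum_congr rfl fun v _ => ?_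
    simp
    left
    congr 1
    ring
  · exact hs.comp_injective (Int.divModEquiv q₂).symm.injective

lemma psi_neg (hodd₂ : χ₂ (-1) = -1) (x : ℂ) :
    ∑' m : ℤ, χ₂ (m : ZMod q₂) * Kr 0 (-x + m) = - ∑' m : ℤ, χ₂ (m : ZMod q₂) * Kr 0 (x + m) := by
  rw [← (Equiv.neg ℤ).tsum_eq, ← tsum_neg]
  refine tsum_congr fun m => ?_
  have : χ₂ (-(m : ZMod q₂)) = - χ₂ m := by
    rw [← neg_one_mul, map_mul, hodd₂]; ring
  rw [← Kr_neg]
  simp [this]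
  left
  congr 1; ring

lemma psi_val (hχ₂ : χ₂.IsPrimitive) {x : ℂ} (hx : 0 < x.im) :
    ∑' n : ℤ, ∑ v ∈ Finset.range q₂, χ₂ ((v : ℕ) : ZMod q₂) * Kr 0 (q₂ * (x + n) + v)
      = ((q₂ : ℂ) ^ 2)⁻¹ * (2 * Real.pi * I) ^ 2 * gaussSum' χ₂ *
        ∑' k : ℕ+, χ₂⁻¹ ((k : ℕ) : ZMod q₂) * k * eC (k * x) := by
  have hq : (q₂ : ℂ) ≠ 0 := NeZero.ne _
  have hK : ∀ (n : ℤ) (v : ℕ), Kr 0 (q₂ * (x + n) + v)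
      = ((q₂ : ℂ) ^ 2)⁻¹ * (((x + v / q₂) + n) ^ 2)⁻¹ := by
    intro n v
    rw [Kr_zero, ← mul_inv, ← mul_pow]; congr 2; field_simp; ring
  simp only [hK]
  rw [Summable.tsum_finsetSum (fun v _ => ((summable_inv_sq _).mul_left _).mul_left _)]
  have him : ∀ v : ℕ, 0 < (x + v / q₂).im := by
    intro v
    have : ((v : ℂ) / q₂).im = 0 := by
      rw [← Complex.ofReal_natCast, ← Complex.ofReal_natCast, ← Complex.ofReal_div, Complex.ofReal_im]
    rw [Complex.add_im, this]; simpa using hx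
  have hL : ∀ v : ℕ, ∑' n : ℤ, (((x + v / q₂) + n) ^ 2)⁻¹ = (2 * Real.pi * I) ^ 2 *
      ∑' k : ℕ+, (k : ℂ) * (eC (k * x) * eC (k * (v / q₂))) := by
    intro v
    have h := EisensteinSeries.qExpansion_identity_pnat (k := 1) le_rfl ⟨x + v / q₂, him v⟩
    simp only [one_div, Nat.factorial_one, Nat.cast_one, div_one, pow_one,
      Nat.reduceAdd] at h
    rw [h, show (-2 * (Real.pi : ℂ) * I) ^ 2 = (2 * Real.pi * I) ^ 2 by ring]
    congr 1
    refine tsum_congr fun k => ?_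
    rw [← eC_add, ← mul_add, ← eC_natmul]; rfl
  have hsum : ∀ v : ℕ, Summable fun k : ℕ+ => (k : ℂ) * (eC (k * x) * eC (k * (v / q₂))) := by
    intro v
    have h := summable_pow_mul_geometric_of_norm_lt_one 1 (norm_eC_lt_one (him v))
    refine (h.comp_injective PNat.coe_injective).congr fun k => ?_
    simp only [Function.comp_apply, pow_one]
    rw [eC_natmul, ← eC_add, ← mul_add]
  have hv : ∀ v : ℕ, ∑' n : ℤ, χ₂ ((v : ℕ) : ZMod q₂) * (((q₂ : ℂ) ^ 2)⁻¹ * (((x + v / q₂) + n) ^ 2)⁻¹)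
      = ((q₂ : ℂ) ^ 2)⁻¹ * (2 * Real.pi * I) ^ 2 *
        ∑' k : ℕ+, χ₂ ((v : ℕ) : ZMod q₂) * ((k : ℂ) * (eC (k * x) * eC (k * (v / q₂)))) := by
    intro v
    rw [tsum_mul_left, tsum_mul_left, tsum_mul_left, hL]; ring
  simp only [hv]
  rw [← Finset.mul_sum, ← Summable.tsum_finsetSum (fun v _ => (hsum v).mul_left _),
    mul_assoc _ (gaussSum' χ₂), ← tsum_mul_left (a := gaussSum' χ₂)]
  congr 1
  refine tsum_congr fun k => ?_
  have := gauss_twist hχ₂ (k : ℕ)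
  rw [show gaussSum' χ₂ * (χ₂⁻¹ ((k : ℕ) : ZMod q₂) * k * eC (k * x))
    = (k * eC (k * x)) * (χ₂⁻¹ ((k : ℕ) : ZMod q₂) * gaussSum' χ₂) by ring, ← this, Finset.mul_sum]
  refine Finset.sum_congr rfl fun v _ => ?_
  ring

lemma Sd_val (hq₁ : 1 < q₁) (hodd₁ : χ₁ (-1) = -1) (hodd₂ : χ₂ (-1) = -1)
    (hχ₂ : χ₂.IsPrimitive) {z : ℂ} (hz : 0 < z.im) :
    Sd χ₁ χ₂ z = 2 * (((q₂ : ℂ) ^ 2)⁻¹ * (2 * Real.pi * I) ^ 2 * gaussSum' χ₂) * Es χ₁ χ₂ z := by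
  have hs := Bl_summable χ₁ χ₂ hq₁ hodd₂ hz
  rw [Sd, hs.tsum_prod]
  have hφ : ∀ l : ℤ, ∑' n : ℤ, Bl χ₁ χ₂ z 0 (l, n) = χ₁ (l : ZMod q₁) *
      ∑' n : ℤ, ∑ v ∈ Finset.range q₂, χ₂ ((v : ℕ) : ZMod q₂) * Kr 0 (q₂ * (l * z + n) + v) := by
    intro l
    rw [← tsum_mul_left]; rfl
  rw [tsum_int_eq_zero_add_two_mul_tsum_pnat _ hs.prod]
  · rw [hφ 0, Int.cast_zero, χ₁.map_zero' hq₁.ne', zero_mul, zero_add, nsmul_eq_mul, Es]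
    push_cast
    rw [mul_assoc]
    congr 1
    rw [← tsum_mul_left]
    refine tsum_congr fun l => ?_
    have him : 0 < ((l : ℂ) * z).im := by
      simpa using mul_pos (by exact_mod_cast l.pos : (0:ℝ) < (l : ℕ)) hz
    rw [hφ]
    simp only [Int.cast_natCast]
    rw [psi_val χ₂ hχ₂ him, mul_left_comm, ← tsum_mul_left (a := χ₁ ((l : ℕ) : ZMod q₁))]
    congr 1
    refine tsum_congr fun k => ?_
    rw [mul_assoc (k : ℂ)]; ring
  · intro l
    show (∑' n : ℤ, Bl χ₁ χ₂ z 0 (-l, n)) = ∑' n : ℤ, Bl χ₁ χ₂ z 0 (l, n)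
    rw [hφ, hφ, psi_eq, psi_eq]
    have e : (q₂ : ℂ) * (((-l : ℤ) : ℂ) * z) = - (q₂ * (l * z)) := by push_cast; ring
    rw [e, psi_neg χ₂ hodd₂]
    have : χ₁ (((-l : ℤ)) : ZMod q₁) = - χ₁ l := by
      rw [Int.cast_neg, ← neg_one_mul, map_mul, hodd₁]; ring
    rw [this]; ring

/-- termwise data for `fE` as a sum over pairs -/
noncomputable def fT (p : ℕ+ × ℕ+) (z : ℂ) : ℂ :=
  χ₁ ((p.1 : ℕ) : ZMod q₁) * χ₂⁻¹ ((p.2 : ℕ) : ZMod q₂) / (p.1 : ℂ)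
      * eC ((p.2 : ℂ) * (p.1 : ℂ) * z)

lemma fT_bound {y₀ : ℝ} (p : ℕ+ × ℕ+) {z : ℂ} (hz : y₀ < z.im) :
    ‖fT χ₁ χ₂ p z‖ ≤ Real.exp (-2 * Real.pi * y₀) ^ (p.1 * p.2 : ℕ) := by
  unfold fT
  rw [norm_mul, norm_div, norm_mul, norm_eC, ← Real.exp_nat_mul]
  have h1 : ‖χ₁ ((p.1 : ℕ) : ZMod q₁)‖ * ‖χ₂⁻¹ ((p.2 : ℕ) : ZMod q₂)‖ / ‖(p.1 : ℂ)‖ ≤ 1 := by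
    have hp : (1:ℝ) ≤ ‖(p.1 : ℂ)‖ := by
      rw [Complex.norm_natCast]; exact_mod_cast p.1.pos
    rw [div_le_one (by linarith)]
    refine le_trans ?_ hp
    exact mul_le_one₀ (DirichletCharacter.norm_le_one _ _) (norm_nonneg _)
      (DirichletCharacter.norm_le_one _ _)
  refine (mul_le_of_le_one_left (Real.exp_pos _).le h1).trans ?_
  apply Real.exp_le_exp.mpr
  have : ((p.2 : ℂ) * (p.1 : ℂ) * z).im = (p.1 * p.2 : ℝ) * z.im := by
    rw [mul_comm (p.2 : ℂ), ← Complex.ofReal_natCast, ← Complex.ofReal_natCast,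
      ← Complex.ofReal_mul, Complex.im_ofReal_mul]
  rw [this]
  push_cast
  have h2 : (0:ℝ) ≤ (p.1 : ℝ) * p.2 * (2 * Real.pi) := by positivity
  nlinarith [mul_le_mul_of_nonneg_left hz.le h2]

lemma exp_lt {y₀ : ℝ} (h : 0 < y₀) : ‖Real.exp (-2 * Real.pi * y₀)‖ < 1 := by
  rw [Real.norm_eq_abs, abs_of_pos (Real.exp_pos _), Real.exp_lt_one_iff]
  nlinarith [mul_pos Real.pi_pos h]

lemma bound_summable {y₀ : ℝ} (h : 0 < y₀) :
    Summable fun p : ℕ+ × ℕ+ => Real.exp (-2 * Real.pi * y₀) ^ (p.1 * p.2 : ℕ) := by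
  simpa using summable_prod_mul_pow 0 (exp_lt h)

lemma fT_summable {z : ℂ} (hz : 0 < z.im) : Summable fun p => fT χ₁ χ₂ p z :=
  Summable.of_norm_bounded (bound_summable (half_pos hz)) fun p =>
    fT_bound χ₁ χ₂ p (half_lt_self hz)

lemma fE_eq {z : ℂ} (hz : 0 < z.im) : fE χ₁ χ₂ z = ∑' p, fT χ₁ χ₂ p z := by
  rw [(fT_summable χ₁ χ₂ hz).tsum_prod, fE]
  simp only [conj_apply_eq_inv]
  rfl

lemma fT_deriv (p : ℕ+ × ℕ+) (z : ℂ) :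
    HasDerivAt (fT χ₁ χ₂ p) (2 * Real.pi * I * (χ₁ ((p.1 : ℕ) : ZMod q₁) *
      χ₂⁻¹ ((p.2 : ℕ) : ZMod q₂) * p.2 * eC ((p.2 : ℂ) * (p.1 : ℂ) * z))) z := by
  unfold fT eC
  have hp : (p.1 : ℂ) ≠ 0 := by exact_mod_cast p.1.ne_zero
  have h := ((((hasDerivAt_id z).const_mul ((p.2 : ℂ) * (p.1 : ℂ))).const_mul
    (2 * Real.pi * I)).cexp).const_mul
    (χ₁ ((p.1 : ℕ) : ZMod q₁) * χ₂⁻¹ ((p.2 : ℕ) : ZMod q₂) / (p.1 : ℂ))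
  refine h.congr_deriv ?_
  simp only [id]
  field_simp

lemma fE_deriv {z : ℂ} (hz : 0 < z.im) :
    HasDerivAt (fE χ₁ χ₂) (2 * Real.pi * I * Es χ₁ χ₂ z) z := by
  set U : Set ℂ := {w | z.im / 2 < w.im}
  have hU : IsOpen U := isOpen_lt continuous_const Complex.continuous_im
  have hzU : z ∈ U := half_lt_self hz
  have hd : ∀ p, DifferentiableOn ℂ (fT χ₁ χ₂ p) U := fun p w _ =>
    (fT_deriv χ₁ χ₂ p w).differentiableAt.differentiableWithinAt
  have hb : ∀ p w, w ∈ U → ‖fT χ₁ χ₂ p w‖ ≤ _ := fun p w hw => fT_bound χ₁ χ₂ p hw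
  have h1 := differentiableOn_tsum_of_summable_norm (bound_summable (half_pos hz)) hd hU hb
  have h2 := hasSum_deriv_of_summable_norm (bound_summable (half_pos hz)) hd hU hb hzU
  have h3 := (h1.differentiableAt (hU.mem_nhds hzU)).hasDerivAt
  have e : deriv (fun w => ∑' p, fT χ₁ χ₂ p w) z = 2 * Real.pi * I * Es χ₁ χ₂ z := by
    rw [← h2.tsum_eq, h2.summable.tsum_prod, Es, ← tsum_mul_left]
    refine tsum_congr fun l => ?_
    rw [← tsum_mul_left]
    refine tsum_congr fun k => ?_
    rw [(fT_deriv χ₁ χ₂ (l, k) z).deriv]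
  rw [e] at h3
  refine h3.congr_of_eventuallyEq ?_
  filter_upwards [hU.mem_nhds hzU] with w hw
  exact fE_eq χ₁ χ₂ ((half_pos hz).trans hw)
end

set_option linter.unusedSectionVars false
open Complex
open Filter Topology

lemma const_of_deriv {f : ℂ → ℂ} (hf : ∀ z : ℂ, 0 < z.im → HasDerivAt f 0 z) {z w : ℂ}
    (hz : 0 < z.im) (hw : 0 < w.im) : f z = f w := by
  have ho : IsOpen {z : ℂ | 0 < z.im} := isOpen_lt continuous_const Complex.continuous_im
  have hc : IsPreconnected {z : ℂ | 0 < z.im} := (convex_halfSpace_im_gt 0).isPreconnected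
  exact ho.is_const_of_deriv_eq_zero hc
    (fun x hx => (hf x hx).differentiableAt.differentiableWithinAt)
    (fun x hx => (hf x hx).deriv) hz hw

section
variable {q₁ q₂ : ℕ} [NeZero q₁] [NeZero q₂] (χ₁ : DirichletCharacter ℂ q₁)
    (χ₂ : DirichletCharacter ℂ q₂)

lemma char_mul_one {q : ℕ} [NeZero q] (χ : DirichletCharacter ℂ q) {a d : ZMod q} (h : a * d = 1) :
    χ a * χ d = 1 := by
  rw [← map_mul, h, map_one]

lemma char_inv_eq {q : ℕ} [NeZero q] (χ : DirichletCharacter ℂ q) {a d : ZMod q} (h : a * d = 1) :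
    χ⁻¹ d = χ a := by
  have h1 : χ⁻¹ d * χ d = 1 := by
    rw [← MulChar.mul_apply, inv_mul_cancel, MulChar.one_apply]
    exact IsUnit.of_mul_eq_one a (by rw [mul_comm]; exact h)
  have h2 := char_mul_one χ h
  have h3 : χ d ≠ 0 := right_ne_zero_of_mul_eq_one h2
  exact mul_right_cancel₀ h3 (h1.trans h2.symm)

lemma det_mod {a b c d : ℤ} {q₁ q₂ : ℕ} (h : a * d - b * (c * (q₁ * q₂ : ℕ)) = 1) :
    ((a : ℤ) : ZMod q₁) * ((d : ℤ) : ZMod q₁) = 1 ∧ ((a : ℤ) : ZMod q₂) * ((d : ℤ) : ZMod q₂) = 1 := by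
  constructor
  · have := congrArg (Int.cast : ℤ → ZMod q₁) h
    simpa using this
  · have := congrArg (Int.cast : ℤ → ZMod q₂) h
    simpa using this

lemma two_pi_I_ne : (2 * Real.pi * I : ℂ) ≠ 0 := Complex.two_pi_I_ne_zero

lemma Es_mod (hq₁ : 1 < q₁) (hodd₁ : χ₁ (-1) = -1) (hodd₂ : χ₂ (-1) = -1)
    (hχ₂ : χ₂.IsPrimitive) (a b c d : ℤ)
    (h : a * d - b * (c * (q₁ * q₂ : ℕ)) = 1) {z : ℂ} (hz : 0 < z.im) :
    ((((c * (q₁ * q₂ : ℕ) : ℤ) : ℂ) * z + d) ^ 2)⁻¹ *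
      Es χ₁ χ₂ ((a * z + b) / (((c * (q₁ * q₂ : ℕ) : ℤ) : ℂ) * z + d))
      = χ₁ (d : ZMod q₁) * χ₂⁻¹ (d : ZMod q₂) * Es χ₁ χ₂ z := by
  have h1 := Sd_mod χ₁ χ₂ hq₁ hodd₂ a b c d h hz
  rw [Sd_val χ₁ χ₂ hq₁ hodd₁ hodd₂ hχ₂ hz, Sd_val χ₁ χ₂ hq₁ hodd₁ hodd₂ hχ₂ (moeb_im h hz)] at h1
  have hq2' : (q₂ : ℂ) ≠ 0 := NeZero.ne _
  have hne : 2 * (((q₂ : ℂ) ^ 2)⁻¹ * (2 * Real.pi * I) ^ 2 * gaussSum' χ₂) ≠ 0 :=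
    mul_ne_zero two_ne_zero (mul_ne_zero (mul_ne_zero (inv_ne_zero (pow_ne_zero _ hq2'))
      (pow_ne_zero _ two_pi_I_ne)) (gauss_ne_zero hχ₂ hodd₂))
  obtain ⟨e1, e2⟩ := det_mod h
  have f1 := char_mul_one χ₁ e1
  have f2 := char_mul_one χ₂ e2
  rw [char_inv_eq χ₂ e2]
  set K := 2 * (((q₂ : ℂ) ^ 2)⁻¹ * (2 * Real.pi * I) ^ 2 * gaussSum' χ₂)
  set J := ((((c * (q₁ * q₂ : ℕ) : ℤ) : ℂ) * z + d) ^ 2)⁻¹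
  apply mul_left_cancel₀ hne
  set X := Es χ₁ χ₂ ((a * z + b) / (((c * (q₁ * q₂ : ℕ) : ℤ) : ℂ) * z + d))
  linear_combination (χ₁ (d : ZMod q₁) * χ₂ (a : ZMod q₂)) * h1
    - (K * J * X) * (f1 * (χ₂ (a : ZMod q₂) * χ₂ (d : ZMod q₂)) + f2)

lemma f_mod_const (hq₁ : 1 < q₁) (hodd₁ : χ₁ (-1) = -1) (hodd₂ : χ₂ (-1) = -1)
    (hχ₂ : χ₂.IsPrimitive) (a b c d : ℤ)
    (h : a * d - b * (c * (q₁ * q₂ : ℕ)) = 1) {z w : ℂ} (hz : 0 < z.im) (hw : 0 < w.im) :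
    fE χ₁ χ₂ ((a * z + b) / (((c * (q₁ * q₂ : ℕ) : ℤ) : ℂ) * z + d))
      - χ₁ (d : ZMod q₁) * χ₂⁻¹ (d : ZMod q₂) * fE χ₁ χ₂ z =
    fE χ₁ χ₂ ((a * w + b) / (((c * (q₁ * q₂ : ℕ) : ℤ) : ℂ) * w + d))
      - χ₁ (d : ZMod q₁) * χ₂⁻¹ (d : ZMod q₂) * fE χ₁ χ₂ w := by
  refine const_of_deriv (f := fun z => fE χ₁ χ₂ ((a * z + b) / (((c * (q₁ * q₂ : ℕ) : ℤ) : ℂ) * z + d))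
      - χ₁ (d : ZMod q₁) * χ₂⁻¹ (d : ZMod q₂) * fE χ₁ χ₂ z) (fun z hz => ?_) hz hw
  have hne : ((c * (q₁ * q₂ : ℕ) : ℤ) : ℂ) * z + d ≠ 0 := by
    apply den_ne _ hz
    by_contra hh
    push Not at hh
    rw [hh.1, hh.2] at h
    simp at h
  have h1 : HasDerivAt (fun z : ℂ => (a * z + b) / (((c * (q₁ * q₂ : ℕ) : ℤ) : ℂ) * z + d))
      ((((c * (q₁ * q₂ : ℕ) : ℤ) : ℂ) * z + d) ^ 2)⁻¹ z := by
    have hn : HasDerivAt (fun z : ℂ => (a : ℂ) * z + b) (a * 1) z :=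
      ((hasDerivAt_id z).const_mul (a : ℂ)).add_const _
    have hd : HasDerivAt (fun z : ℂ => ((c * (q₁ * q₂ : ℕ) : ℤ) : ℂ) * z + d)
        (((c * (q₁ * q₂ : ℕ) : ℤ) : ℂ) * 1) z :=
      ((hasDerivAt_id z).const_mul _).add_const _
    refine (hn.div hd hne).congr_deriv ?_
    have hC : (a : ℂ) * d - b * ((c * (q₁ * q₂ : ℕ) : ℤ) : ℂ) = 1 := by exact_mod_cast h
    rw [inv_eq_one_div]
    congr 1
    linear_combination hC
  have h2 := (fE_deriv χ₁ χ₂ (moeb_im h hz)).comp z h1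
  have h3 := h2.sub ((fE_deriv χ₁ χ₂ hz).const_mul (χ₁ (d : ZMod q₁) * χ₂⁻¹ (d : ZMod q₂)))
  refine h3.congr_deriv ?_
  have := Es_mod χ₁ χ₂ hq₁ hodd₁ hodd₂ hχ₂ a b c d h hz
  linear_combination (2 * Real.pi * I) * this

lemma W_im {z : ℂ} (hz : 0 < z.im) : 0 < (-1 / ((q₁ : ℂ) * q₂ * z)).im := by
  have hq1' : (0:ℝ) < q₁ := by exact_mod_cast Nat.pos_of_ne_zero (NeZero.ne q₁)
  have hq2' : (0:ℝ) < q₂ := by exact_mod_cast Nat.pos_of_ne_zero (NeZero.ne q₂)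
  have hz0 : z ≠ 0 := by rintro rfl; simp at hz
  have : -1 / ((q₁ : ℂ) * q₂ * z) = (((q₁ : ℝ) * q₂)⁻¹ : ℝ) * (-z⁻¹) := by
    push_cast; field_simp
  rw [this, Complex.im_ofReal_mul, Complex.neg_im, Complex.inv_im]
  have : 0 < Complex.normSq z := Complex.normSq_pos.mpr hz0
  rw [neg_div, neg_neg]
  positivity

lemma fricke_const (hq₁ : 1 < q₁) (hq₂ : 1 < q₂) (hodd₁ : χ₁ (-1) = -1) (hodd₂ : χ₂ (-1) = -1)
    (hχ₁ : χ₁.IsPrimitive) (hχ₂ : χ₂.IsPrimitive) {z w : ℂ} (hz : 0 < z.im) (hw : 0 < w.im) :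
    gaussSum' χ₁⁻¹ * fE χ₁ χ₂ z + gaussSum' χ₂⁻¹ * fE χ₂ χ₁ (-1 / ((q₁ : ℂ) * q₂ * z)) =
    gaussSum' χ₁⁻¹ * fE χ₁ χ₂ w + gaussSum' χ₂⁻¹ * fE χ₂ χ₁ (-1 / ((q₁ : ℂ) * q₂ * w)) := by
  refine const_of_deriv (f := fun z => gaussSum' χ₁⁻¹ * fE χ₁ χ₂ z +
    gaussSum' χ₂⁻¹ * fE χ₂ χ₁ (-1 / ((q₁ : ℂ) * q₂ * z))) (fun z hz => ?_) hz hw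
  have hq1' : (q₁ : ℂ) ≠ 0 := NeZero.ne _
  have hq2' : (q₂ : ℂ) ≠ 0 := NeZero.ne _
  have hz0 : z ≠ 0 := by rintro rfl; simp at hz
  have hW := W_im (q₁ := q₁) (q₂ := q₂) hz
  have h1 : HasDerivAt (fun z : ℂ => -1 / ((q₁ : ℂ) * q₂ * z)) (((q₁ : ℂ) * q₂ * z ^ 2)⁻¹) z := by
    have hd : HasDerivAt (fun z : ℂ => (q₁ : ℂ) * q₂ * z) ((q₁ : ℂ) * q₂ * 1) z :=
      (hasDerivAt_id z).const_mul _
    refine ((hasDerivAt_const z (-1 : ℂ)).div hd (mul_ne_zero (mul_ne_zero hq1' hq2') hz0)).congr_deriv ?_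
    field_simp
    simp
  have h2 := (fE_deriv χ₂ χ₁ hW).comp z h1
  have h3 := ((fE_deriv χ₁ χ₂ hz).const_mul (gaussSum' χ₁⁻¹)).add (h2.const_mul (gaussSum' χ₂⁻¹))
  refine h3.congr_deriv ?_
  have hS := Sd_fricke χ₁ χ₂ hq₁ hq₂ hodd₁ hodd₂ hz hW
  rw [Sd_val χ₁ χ₂ hq₁ hodd₁ hodd₂ hχ₂ hz, Sd_val χ₂ χ₁ hq₂ hodd₂ hodd₁ hχ₁ hW] at hS
  have hp : (2 * Real.pi * I : ℂ) ≠ 0 := two_pi_I_ne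
  have g1 := gauss_mul_gauss hχ₁ hodd₁
  have g2 := gauss_mul_gauss hχ₂ hodd₂
  have hg := gauss_ne_zero hχ₁ hodd₁
  set X := Es χ₂ χ₁ (-1 / ((q₁ : ℂ) * q₂ * z))
  set Y := Es χ₁ χ₂ z
  set P := (2 * Real.pi * I : ℂ)
  have hX : gaussSum' χ₁ * X = - (q₁ : ℂ) ^ 2 * z ^ 2 * gaussSum' χ₂ * Y := by
    have hk : (2 * P ^ 2 * ((q₁ : ℂ) ^ 2)⁻¹) ≠ 0 :=
      mul_ne_zero (mul_ne_zero two_ne_zero (pow_ne_zero _ hp)) (inv_ne_zero (pow_ne_zero _ hq1'))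
    apply mul_left_cancel₀ hk
    field_simp at hS ⊢
    linear_combination hS
  apply mul_left_cancel₀ hg
  have hN : ((q₁ : ℂ) * q₂ * z ^ 2)⁻¹ * ((q₁ : ℂ) * q₂ * z ^ 2) = 1 :=
    inv_mul_cancel₀ (mul_ne_zero (mul_ne_zero hq1' hq2') (pow_ne_zero _ hz0))
  set V := ((q₁ : ℂ) * q₂ * z ^ 2)⁻¹
  linear_combination (P * Y) * g1 + (P * V * gaussSum' χ₂⁻¹) * hX
    - (P * V * q₁ ^ 2 * z ^ 2 * Y) * g2 + (P * Y * q₁) * hN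
end

set_option linter.unusedSectionVars false
open Complex
open Filter Topology

section
variable {q : ℕ} [NeZero q] (χ : DirichletCharacter ℂ q)

lemma block_eq {u : ℕ → ℂ} (hs : Summable fun l : ℕ => χ (l : ZMod q) * u l) :
    ∑' l : ℕ, χ (l : ZMod q) * u l = ∑' j : ℕ, ∑ r ∈ Finset.range q, χ (r : ZMod q) * u (j * q + r) := by
  rw [← (Nat.divModEquiv q).symm.tsum_eq (fun l : ℕ => χ (l : ZMod q) * u l), Summable.tsum_prod]
  · refine tsum_congr fun j => ?_
    rw [tsum_fintype, ← Fin.sum_univ_eq_sum_range (fun r : ℕ => χ (r : ZMod q) * u (j * q + r))]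
    refine Finset.sum_congr rfl fun v _ => ?_
    simp
  · exact hs.comp_injective (Nat.divModEquiv q).symm.injective

lemma block_bound (hq : 1 < q) (hodd : χ (-1) = -1) {u : ℕ → ℂ} {K : ℝ} (hK0 : 0 ≤ K)
    (hK : ∀ l l' : ℕ, 1 ≤ l → l ≤ l' → ‖u l - u l'‖ ≤ K * (l' - l) / l ^ 2) (j : ℕ) :
    ‖∑ r ∈ Finset.range q, χ (r : ZMod q) * u (j * q + r)‖ ≤ (q * (K * q)) * (1 / ((j + 1 : ℕ) : ℝ) ^ 2) := by
  have e : ∑ r ∈ Finset.range q, χ (r : ZMod q) * u (j * q + r)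
      = ∑ r ∈ Finset.range q, χ (r : ZMod q) * (u (j * q + r) - u (j * q + 1)) := by
    simp only [mul_sub, Finset.sum_sub_distrib]
    rw [← Finset.sum_mul, sum_char_range hodd]; ring
  rw [e]
  refine (norm_sum_le _ _).trans ?_
  have : ∀ r ∈ Finset.range q, ‖χ (r : ZMod q) * (u (j * q + r) - u (j * q + 1))‖
      ≤ (K * q) * (1 / ((j + 1 : ℕ) : ℝ) ^ 2) := by
    intro r hr
    rcases Nat.eq_zero_or_pos r with rfl | hr0
    · rw [Nat.cast_zero, χ.map_zero' hq.ne', zero_mul, norm_zero]; positivity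
    · rw [norm_mul, norm_sub_rev]
      refine (mul_le_of_le_one_left (norm_nonneg _) (DirichletCharacter.norm_le_one _ _)).trans ?_
      refine (hK _ _ (by omega) (by omega)).trans ?_
      rw [← mul_one_div]
      have hr' : (r : ℝ) ≤ q := by exact_mod_cast (Finset.mem_range.mp hr).le
      have hr1 : (1 : ℝ) ≤ r := by exact_mod_cast hr0
      have hj : ((j + 1 : ℕ) : ℝ) ≤ ((j * q + 1 : ℕ) : ℝ) := by
        have : j * 1 ≤ j * q := Nat.mul_le_mul_left _ hq.le
        exact_mod_cast (by omega : j + 1 ≤ j * q + 1)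
      have hj0 : (0:ℝ) < ((j + 1 : ℕ) : ℝ) := by positivity
      gcongr
      · push_cast; linarith
  refine (Finset.sum_le_sum this).trans ?_
  rw [Finset.sum_const, Finset.card_range, nsmul_eq_mul]
  exact le_of_eq (by ring)

lemma block_tendsto (hq : 1 < q) (hodd : χ (-1) = -1) {ι : Type*} {F : Filter ι} {g : ι → ℕ → ℂ}
    {g' : ℕ → ℂ} {K : ℝ} (hK0 : 0 ≤ K)
    (hK : ∀ᶠ i in F, ∀ l l' : ℕ, 1 ≤ l → l ≤ l' → ‖g i l - g i l'‖ ≤ K * (l' - l) / l ^ 2)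
    (hs : ∀ᶠ i in F, Summable fun l : ℕ => χ (l : ZMod q) * g i l)
    (ht : ∀ l : ℕ, 1 ≤ l → Tendsto (fun i => g i l) F (𝓝 (g' l))) :
    Tendsto (fun i => ∑' l : ℕ, χ (l : ZMod q) * g i l) F
      (𝓝 (∑' j : ℕ, ∑ r ∈ Finset.range q, χ (r : ZMod q) * g' (j * q + r))) := by
  have h : Tendsto (fun i => ∑' j : ℕ, ∑ r ∈ Finset.range q, χ (r : ZMod q) * g i (j * q + r)) F
      (𝓝 (∑' j : ℕ, ∑ r ∈ Finset.range q, χ (r : ZMod q) * g' (j * q + r))) := by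
    refine tendsto_tsum_of_dominated_convergence
      (bound := fun j : ℕ => (q * (K * q)) * (1 / ((j + 1 : ℕ) : ℝ) ^ 2)) ?_ ?_ ?_
    · exact (((summable_nat_add_iff 1).mpr (Real.summable_one_div_nat_pow.mpr one_lt_two))).mul_left _
    · intro j
      refine tendsto_finsetSum _ fun r _ => ?_
      rcases Nat.eq_zero_or_pos r with rfl | hr0
      · rw [Nat.cast_zero, χ.map_zero' hq.ne']; simpa using tendsto_const_nhds
      · exact (ht _ (by omega)).const_mul _
    · filter_upwards [hK] with i hi j
      exact block_bound χ hq hodd hK0 hi j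
  refine h.congr' ?_
  filter_upwards [hs] with i hi
  exact (block_eq χ hi).symm

noncomputable def Sl : ℂ := ∑' j : ℕ, ∑ r ∈ Finset.range q, χ (r : ZMod q) * (1 / ((j * q + r : ℕ) : ℂ))

lemma Sl_mul (c : ℂ) : ∑' j : ℕ, ∑ r ∈ Finset.range q, χ (r : ZMod q) * (c / ((j * q + r : ℕ) : ℂ))
    = c * Sl χ := by
  rw [Sl, ← tsum_mul_left]
  refine tsum_congr fun j => ?_
  rw [Finset.mul_sum]
  refine Finset.sum_congr rfl fun r _ => ?_
  ring

lemma abel_lim (hq : 1 < q) (hodd : χ (-1) = -1) {h : ℝ → ℂ} {h0 : ℂ} {M : ℝ} (hM0 : 0 ≤ M)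
    (hM : ∀ x, 0 < x → ‖h x‖ ≤ M)
    (hL : ∀ x x', 0 < x → x ≤ x' → ‖h x - h x'‖ ≤ M * (x' - x) / x)
    (hs : ∀ y : ℝ, 0 < y → Summable fun l : ℕ => χ (l : ZMod q) * (h (l * y) / l))
    (h0t : Tendsto h (𝓝[>] 0) (𝓝 h0)) :
    Tendsto (fun y : ℝ => ∑' l : ℕ, χ (l : ZMod q) * (h (l * y) / l)) (𝓝[>] 0) (𝓝 (h0 * Sl χ)) := by
  rw [← Sl_mul]
  refine block_tendsto χ hq hodd (g := fun y l => h (l * y) / l) (g' := fun l => h0 / l)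
    (K := 2 * M) (by positivity) ?_ ?_ ?_
  · filter_upwards [self_mem_nhdsWithin] with y hy l l' hl hll
    have hy : 0 < y := hy
    have hl0 : (0:ℝ) < l := by exact_mod_cast hl
    have hll' : (l:ℝ) ≤ l' := by exact_mod_cast hll
    have hl0' : (0:ℝ) < l' := hl0.trans_le hll'
    have c0 : (l : ℂ) ≠ 0 := by exact_mod_cast hl0.ne'
    have c0' : (l' : ℂ) ≠ 0 := by exact_mod_cast hl0'.ne'
    have e : h (l * y) / l - h (l' * y) / l' = (h (l * y) - h (l' * y)) / l
        + h (l' * y) * (((l' - l) / (l * l') : ℝ) : ℂ) := by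
      push_cast
      field_simp
      ring
    rw [e]
    refine (norm_add_le _ _).trans ?_
    rw [norm_div, norm_mul, Complex.norm_natCast, Complex.norm_real, Real.norm_eq_abs,
      abs_of_nonneg (div_nonneg (by linarith) (by positivity))]
    have a1 : ‖h (l * y) - h (l' * y)‖ / l ≤ M * (l' - l) / l ^ 2 := by
      have := hL (l * y) (l' * y) (by positivity) (by gcongr)
      rw [div_le_iff₀ hl0]
      refine this.trans (le_of_eq ?_)
      field_simp
    have a2 : ‖h (l' * y)‖ * ((l' - l) / (l * l')) ≤ M * ((l' - l) / (l * l)) := by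
      have := hM (l' * y) (by positivity)
      have : (0:ℝ) ≤ l' - l := by linarith
      gcongr
    calc _ ≤ M * (l' - l) / l ^ 2 + M * ((l' - l) / (l * l)) := add_le_add a1 a2
      _ = _ := by field_simp; ring
  · filter_upwards [self_mem_nhdsWithin] with y hy
    exact hs y hy
  · intro l hl
    have hl0 : (0:ℝ) < l := by exact_mod_cast hl
    refine Tendsto.div_const (h0t.comp ?_) _
    refine tendsto_nhdsWithin_iff.mpr ⟨?_, ?_⟩
    · have : Tendsto (fun y : ℝ => (l:ℝ) * y) (𝓝 0) (𝓝 (l * 0)) := tendsto_id.const_mul _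
      rw [mul_zero] at this
      exact this.mono_left nhdsWithin_le_nhds
    · filter_upwards [self_mem_nhdsWithin] with y hy
      exact mul_pos hl0 hy

lemma rpow_diff {s : ℝ} (hs : 1 ≤ s) (hs2 : s ≤ 2) {l l' : ℝ} (hl : 1 ≤ l) (hll : l ≤ l') :
    |l ^ (-s) - l' ^ (-s)| ≤ 2 * (l' - l) / l ^ 2 := by
  have hl0 : 0 < l := by linarith
  have hl0' : 0 < l' := by linarith
  rw [abs_of_nonneg (sub_nonneg.mpr (Real.rpow_le_rpow_of_nonpos hl0 hll (by linarith)))]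
  have hb := one_add_mul_self_le_rpow_one_add (s := l / l' - 1) (by
    have : 0 < l / l' := by positivity
    linarith) hs
  have e1 : (1 + (l / l' - 1)) ^ s = l ^ s / l' ^ s := by
    rw [add_sub_cancel, Real.div_rpow hl0.le hl0'.le]
  rw [e1] at hb
  rw [Real.rpow_neg hl0.le, Real.rpow_neg hl0'.le]
  have p1 : 0 < l ^ s := Real.rpow_pos_of_pos hl0 _
  have p2 : 0 < l' ^ s := Real.rpow_pos_of_pos hl0' _
  have e2 : (l ^ s)⁻¹ - (l' ^ s)⁻¹ = (l ^ s)⁻¹ * (1 - l ^ s / l' ^ s) := by field_simp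
  rw [e2]
  have h3 : (l ^ s)⁻¹ ≤ l⁻¹ := by
    apply inv_anti₀ hl0
    simpa using Real.rpow_le_rpow_of_exponent_le hl hs
  have h4 : 1 - l ^ s / l' ^ s ≤ s * ((l' - l) / l') := by
    have : (l' - l) / l' = 1 - l / l' := by field_simp
    rw [this]; linarith
  have h5 : s * ((l' - l) / l') ≤ 2 * ((l' - l) / l) := by
    have : 0 ≤ l' - l := by linarith
    gcongr
  have h6 : 0 ≤ 2 * ((l' - l) / l) := by
    have : 0 ≤ l' - l := by linarith
    positivity
  calc _ ≤ (l ^ s)⁻¹ * (2 * ((l' - l) / l)) := by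
        apply mul_le_mul_of_nonneg_left (h4.trans h5) (by positivity)
    _ ≤ l⁻¹ * (2 * ((l' - l) / l)) := mul_le_mul_of_nonneg_right h3 h6
    _ = _ := by field_simp

lemma Sl_eq_L (hq : 1 < q) (hodd : χ (-1) = -1) : Sl χ = DirichletCharacter.LFunction χ 1 := by
  have hne : χ ≠ 1 := odd_ne_one hodd
  have h1 := block_tendsto χ hq hodd (F := 𝓝[>] (1:ℝ)) (g := fun s l => (((l:ℝ) ^ (-s) : ℝ) : ℂ))
    (g' := fun l => 1 / (l : ℂ)) (K := 2) (by norm_num) ?_ ?_ ?_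
  · have h2 : Tendsto (fun s : ℝ => DirichletCharacter.LFunction χ s) (𝓝[>] (1:ℝ))
        (𝓝 (DirichletCharacter.LFunction χ (1:ℝ))) := by
      have hc := (DirichletCharacter.differentiable_LFunction hne).continuous
      exact ((hc.comp Complex.continuous_ofReal).tendsto 1).mono_left nhdsWithin_le_nhds
    rw [Complex.ofReal_one] at h2
    refine tendsto_nhds_unique h1 (h2.congr' ?_)
    filter_upwards [self_mem_nhdsWithin] with s hs
    have hs : 1 < s := hs
    rw [DirichletCharacter.LFunction_eq_LSeries χ (by simpa using hs), LSeries]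
    refine tsum_congr fun l => ?_
    rcases Nat.eq_zero_or_pos l with rfl | hl
    · simp [χ.map_zero' hq.ne']
    · rw [LSeries.term_of_ne_zero hl.ne', Complex.ofReal_cpow (by positivity)]
      push_cast
      rw [Complex.cpow_neg, div_eq_mul_inv]
  · filter_upwards [Ioo_mem_nhdsGT (one_lt_two)] with s hs l l' hl hll
    rw [← Complex.ofReal_sub, Complex.norm_real, Real.norm_eq_abs]
    exact rpow_diff hs.1.le hs.2.le (by exact_mod_cast hl) (by exact_mod_cast hll)
  · filter_upwards [self_mem_nhdsWithin] with s hs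
    have hs : 1 < s := hs
    refine Summable.of_norm_bounded (Real.summable_nat_rpow.mpr (by linarith : -s < -1)) fun l => ?_
    rw [norm_mul, Complex.norm_real, Real.norm_eq_abs, abs_of_nonneg (by positivity)]
    exact mul_le_of_le_one_left (by positivity) (DirichletCharacter.norm_le_one _ _)
  · intro l hl
    have hl0 : (l:ℝ) ≠ 0 := by exact_mod_cast (by omega : l ≠ 0)
    have hc : Continuous fun s : ℝ => (((l:ℝ) ^ (-s) : ℝ) : ℂ) := by
      refine Complex.continuous_ofReal.comp ?_
      exact Continuous.rpow continuous_const continuous_neg (fun _ => Or.inl hl0)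
    have := (hc.tendsto 1).mono_left (nhdsWithin_le_nhds (s := Set.Ioi 1))
    simpa [Real.rpow_neg_one] using this
end

set_option linter.unusedSectionVars false
open Complex
open Filter Topology

section
variable {q : ℕ} [NeZero q] (χ : DirichletCharacter ℂ q)

noncomputable def Ha (t : ℝ) : ℂ := ∑ r ∈ Finset.range q, χ (r : ZMod q) * ∑ i ∈ Finset.range r, (t : ℂ) ^ i
noncomputable def Hd (q : ℕ) (t : ℝ) : ℂ := ∑ i ∈ Finset.range q, (t : ℂ) ^ i
noncomputable def HH (t : ℝ) : ℂ := - Ha χ t / Hd q t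

lemma Hd_ne {t : ℝ} (ht : 0 ≤ t) : Hd q t ≠ 0 := by
  have : Hd q t = ((∑ i ∈ Finset.range q, t ^ i : ℝ) : ℂ) := by simp [Hd]
  rw [this]
  have h : (1:ℝ) ≤ ∑ i ∈ Finset.range q, t ^ i := by
    have := Finset.single_le_sum (f := fun i => t ^ i) (s := Finset.range q)
      (fun i _ => pow_nonneg ht i) (Finset.mem_range.mpr (Nat.pos_of_ne_zero (NeZero.ne q)))
    simpa using this
  exact Complex.ofReal_ne_zero.mpr (by linarith)

lemma HH_contDiff : ContDiffOn ℝ 1 (HH χ) (Set.Icc 0 1) := by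
  have h1 : ContDiff ℝ 1 (Ha χ) := by
    unfold Ha
    refine ContDiff.sum fun r _ => contDiff_const.mul (ContDiff.sum fun i _ => ?_)
    exact Complex.ofRealCLM.contDiff.pow i
  have h2 : ContDiff ℝ 1 (Hd q) := by
    unfold Hd
    exact ContDiff.sum fun i _ => Complex.ofRealCLM.contDiff.pow i
  unfold HH
  simp only [div_eq_mul_inv]
  have h3 : ContDiffOn ℝ 1 (fun t => (Hd q t)⁻¹) (Set.Icc 0 1) :=
    h2.contDiffOn.inv fun t ht => Hd_ne ht.1
  exact h1.neg.contDiffOn.mul h3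

lemma HH_lip : ∃ M : ℝ, 0 ≤ M ∧ (∀ t ∈ Set.Icc (0:ℝ) 1, ‖HH χ t‖ ≤ M) ∧
    ∀ t ∈ Set.Icc (0:ℝ) 1, ∀ t' ∈ Set.Icc (0:ℝ) 1, ‖HH χ t - HH χ t'‖ ≤ M * |t - t'| := by
  obtain ⟨K, hK⟩ := (HH_contDiff χ).exists_lipschitzOnWith one_ne_zero (convex_Icc 0 1) isCompact_Icc
  obtain ⟨B, hB⟩ := isCompact_Icc.exists_bound_of_continuousOn (HH_contDiff χ).continuousOn
  refine ⟨max K B, le_max_of_le_left K.2, fun t ht => (hB t ht).trans (le_max_right _ _), fun t ht t' ht' => ?_⟩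
  have := hK.dist_le_mul t ht t' ht'
  rw [dist_eq_norm, Real.dist_eq] at this
  exact this.trans (mul_le_mul_of_nonneg_right (le_max_left _ _) (abs_nonneg _))

lemma HH_one : HH χ 1 = - (∑ r ∈ Finset.range q, χ (r : ZMod q) * r) / q := by
  simp [HH, Ha, Hd]

lemma HH_sum (hodd : χ (-1) = -1) {t : ℝ} (ht0 : 0 ≤ t) (ht : t < 1) :
    ∑' k : ℕ, χ (k : ZMod q) * (t : ℂ) ^ k = HH χ t := by
  have hn : ‖(t:ℂ)‖ < 1 := by rw [Complex.norm_real, Real.norm_eq_abs, abs_of_nonneg ht0]; exact ht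
  have hs : Summable fun k : ℕ => χ (k : ZMod q) * (t : ℂ) ^ k := by
    refine Summable.of_norm_bounded (summable_norm_geometric_of_norm_lt_one hn) fun k => ?_
    rw [norm_mul]
    exact mul_le_of_le_one_left (norm_nonneg _) (DirichletCharacter.norm_le_one _ _)
  rw [block_eq χ hs]
  have e : ∀ j : ℕ, ∑ r ∈ Finset.range q, χ (r : ZMod q) * (t : ℂ) ^ (j * q + r)
      = ((t : ℂ) ^ q) ^ j * ∑ r ∈ Finset.range q, χ (r : ZMod q) * (t : ℂ) ^ r := by
    intro j
    rw [Finset.mul_sum]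
    refine Finset.sum_congr rfl fun r _ => ?_
    rw [pow_add, mul_comm j q, pow_mul]; ring
  simp only [e]
  have hnq : ‖(t:ℂ) ^ q‖ < 1 := by
    rw [norm_pow]; exact pow_lt_one₀ (norm_nonneg _) hn (NeZero.ne q)
  rw [tsum_mul_right, tsum_geometric_of_norm_lt_one hnq, HH]
  have h1 : (t:ℂ) - 1 ≠ 0 := by
    rw [sub_ne_zero]; exact_mod_cast ht.ne
  have g : ∀ r : ℕ, (t:ℂ) ^ r = 1 + (∑ i ∈ Finset.range r, (t : ℂ) ^ i) * (t - 1) := by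
    intro r; rw [geom_sum_mul]; ring
  have e1 : ∑ r ∈ Finset.range q, χ (r : ZMod q) * (t : ℂ) ^ r = Ha χ t * (t - 1) := by
    rw [Ha, Finset.sum_mul]
    rw [← add_zero (∑ r ∈ Finset.range q, _ * (t - 1 : ℂ)), ← sum_char_range hodd,
      ← Finset.sum_add_distrib]
    refine Finset.sum_congr rfl fun r _ => ?_
    rw [g r]; ring
  have e2 : 1 - (t:ℂ) ^ q = - (Hd q t * (t - 1)) := by rw [Hd, g q]; ring
  rw [e1, e2]
  have := Hd_ne (q := q) ht0
  field_simp

/-- the exponential -/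
noncomputable def ex (x : ℝ) : ℝ := Real.exp (-(2 * Real.pi * x))

lemma ex_mem {x : ℝ} (hx : 0 < x) : 0 < ex x ∧ ex x < 1 := by
  refine ⟨Real.exp_pos _, ?_⟩
  rw [ex, Real.exp_lt_one_iff]
  have := Real.pi_pos
  nlinarith [mul_pos this hx]

lemma ex_diff {x x' : ℝ} (hx : 0 < x) (h : x ≤ x') : |ex x - ex x'| ≤ (x' - x) / x := by
  have hp := Real.pi_pos
  have hle : ex x' ≤ ex x := by
    rw [ex, ex]; apply Real.exp_le_exp.mpr; nlinarith
  rw [abs_of_nonneg (by linarith)]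
  have e : ex x' = ex x * Real.exp (-(2 * Real.pi * (x' - x))) := by
    rw [ex, ex, ← Real.exp_add]; congr 1; ring
  have h1 : 1 - 2 * Real.pi * (x' - x) ≤ Real.exp (-(2 * Real.pi * (x' - x))) := by
    have := Real.add_one_le_exp (-(2 * Real.pi * (x' - x))); linarith
  have h2 : 2 * Real.pi * x * ex x ≤ 1 := by
    have := Real.add_one_le_exp (2 * Real.pi * x)
    rw [ex, Real.exp_neg]
    have hpos := Real.exp_pos (2 * Real.pi * x)
    rw [mul_inv_le_iff₀ hpos]; linarith
  have h3 := (ex_mem hx).1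
  rw [le_div_iff₀ hx, e]
  have h4 : 0 ≤ x' - x := by linarith
  have h5 : ex x - ex x * Real.exp (-(2 * Real.pi * (x' - x))) ≤ ex x * (2 * Real.pi * (x' - x)) := by
    nlinarith
  calc _ ≤ ex x * (2 * Real.pi * (x' - x)) * x := mul_le_mul_of_nonneg_right h5 hx.le
    _ = (2 * Real.pi * x * ex x) * (x' - x) := by ring
    _ ≤ 1 * (x' - x) := mul_le_mul_of_nonneg_right h2 h4
    _ = _ := one_mul _

lemma ex_tendsto : Tendsto ex (𝓝[>] 0) (𝓝[Set.Icc 0 1] 1) := by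
  refine tendsto_nhdsWithin_iff.mpr ⟨?_, ?_⟩
  · have hc : Continuous ex := by unfold ex; fun_prop
    have := (hc.tendsto 0).mono_left (nhdsWithin_le_nhds (s := Set.Ioi 0))
    simpa [ex] using this
  · filter_upwards [self_mem_nhdsWithin] with x hx
    exact ⟨(ex_mem hx).1.le, (ex_mem hx).2.le⟩

lemma ex_nat (k : ℕ) (x : ℝ) : ex (k * x) = ex x ^ k := by
  rw [ex, ex, ← Real.exp_nat_mul]; congr 1; ring

/-- Abelian limit for functions of `exp (-2 π x)`. -/
lemma abel_ex (hq : 1 < q) (hodd : χ (-1) = -1) {P : ℝ → ℂ} {M : ℝ} (hM0 : 0 ≤ M)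
    (hM : ∀ t ∈ Set.Icc (0:ℝ) 1, ‖P t‖ ≤ M)
    (hL : ∀ t ∈ Set.Icc (0:ℝ) 1, ∀ t' ∈ Set.Icc (0:ℝ) 1, ‖P t - P t'‖ ≤ M * |t - t'|)
    (hP0 : P 0 = 0) (hc : ContinuousOn P (Set.Icc 0 1)) :
    Tendsto (fun y : ℝ => ∑' l : ℕ, χ (l : ZMod q) * (P (ex (l * y)) / l)) (𝓝[>] 0)
      (𝓝 (P 1 * Sl χ)) := by
  have hmem : ∀ x : ℝ, 0 < x → ex x ∈ Set.Icc (0:ℝ) 1 := fun x hx =>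
    ⟨(ex_mem hx).1.le, (ex_mem hx).2.le⟩
  refine abel_lim χ hq hodd (h := fun x => P (ex x)) hM0 (fun x hx => hM _ (hmem x hx)) ?_ ?_ ?_
  · intro x x' hx hxx
    refine (hL _ (hmem x hx) _ (hmem x' (hx.trans_le hxx))).trans ?_
    rw [mul_div_assoc]
    exact mul_le_mul_of_nonneg_left (ex_diff hx hxx) hM0
  · intro y hy
    have hg := summable_geometric_of_lt_one (ex_mem hy).1.le (ex_mem hy).2
    refine Summable.of_norm_bounded (hg.mul_left M) fun l => ?_
    rcases Nat.eq_zero_or_pos l with rfl | hl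
    · simpa using hM0
    · have hl1 : (1:ℝ) ≤ l := by exact_mod_cast hl
      have hly : 0 < (l:ℝ) * y := by positivity
      have h1 := hL _ (hmem _ hly) 0 ⟨le_rfl, zero_le_one⟩
      rw [hP0, sub_zero, sub_zero, abs_of_pos (ex_mem hly).1, ex_nat] at h1
      rw [norm_mul, norm_div, Complex.norm_natCast]
      refine (mul_le_of_le_one_left (by positivity) (DirichletCharacter.norm_le_one _ _)).trans ?_
      rw [← ex_nat] at h1 ⊢
      exact (div_le_self (norm_nonneg _) hl1).trans h1
  · exact (hc 1 ⟨zero_le_one, le_rfl⟩).tendsto.comp ex_tendsto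
end

set_option linter.unusedSectionVars false
open Complex
open Filter Topology

section
variable {q₁ q₂ : ℕ} [NeZero q₁] [NeZero q₂] (χ₁ : DirichletCharacter ℂ q₁)
    (χ₂ : DirichletCharacter ℂ q₂)

lemma pnat_to_nat {u : ℕ → ℂ} (h0 : u 0 = 0) : ∑' l : ℕ+, u l = ∑' l : ℕ, u l := by
  have hi : Function.Injective (fun l : ℕ+ => (l : ℕ)) := PNat.coe_injective
  refine hi.tsum_eq (f := u) fun n hn => ?_
  have : n ≠ 0 := by rintro rfl; exact hn h0
  exact ⟨⟨n, Nat.pos_of_ne_zero this⟩, rfl⟩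

lemma odd_inv {q : ℕ} [NeZero q] {χ : DirichletCharacter ℂ q} (hodd : χ (-1) = -1) : χ⁻¹ (-1) = -1 := by
  rw [← conj_apply_eq_inv, hodd]; simp

lemma eC_ex (k l : ℕ) (y : ℝ) : eC ((k : ℂ) * (l : ℂ) * (I * y)) = ((ex (l * y) : ℝ) : ℂ) ^ k := by
  rw [eC, ex, Complex.ofReal_exp, ← Complex.exp_nat_mul]
  congr 1
  push_cast
  linear_combination (2 * (Real.pi : ℂ) * k * l * y) * Complex.I_mul_I

lemma HH_zero {q : ℕ} [NeZero q] (hq : 1 < q) {χ : DirichletCharacter ℂ q} (hodd : χ (-1) = -1) :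
    HH χ 0 = 0 := by
  rw [← HH_sum χ hodd le_rfl zero_lt_one, tsum_eq_single 0]
  · simp [χ.map_zero' hq.ne']
  · intro k hk; simp [hk]

lemma f_axis (hq₁ : 1 < q₁) (hq₂ : 1 < q₂) (hodd₁ : χ₁ (-1) = -1) {y : ℝ} (hy : 0 < y) :
    fE χ₂ χ₁ (I * y) = ∑' l : ℕ, χ₂ (l : ZMod q₂) * (HH χ₁⁻¹ (ex (l * y)) / l) := by
  rw [← pnat_to_nat (by simp)]
  unfold fE
  refine tsum_congr fun l => ?_
  have hly : 0 < (l : ℝ) * y := mul_pos (by exact_mod_cast l.pos) hy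
  rw [← HH_sum χ₁⁻¹ (odd_inv hodd₁) (ex_mem hly).1.le (ex_mem hly).2,
    ← pnat_to_nat (u := fun k : ℕ => χ₁⁻¹ (k : ZMod q₁) * ((ex (l * y) : ℝ) : ℂ) ^ k)
      (by simp [χ₁⁻¹.map_zero' hq₁.ne']), ← tsum_div_const, ← tsum_mul_left]
  refine tsum_congr fun k => ?_
  rw [conj_apply_eq_inv, eC_ex]
  ring

lemma f_axis_zero (hq₁ : 1 < q₁) (hq₂ : 1 < q₂) (hodd₁ : χ₁ (-1) = -1) (hodd₂ : χ₂ (-1) = -1) :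
    Tendsto (fun y : ℝ => fE χ₂ χ₁ (I * y)) (𝓝[>] 0) (𝓝 (HH χ₁⁻¹ 1 * Sl χ₂)) := by
  obtain ⟨M, hM0, hM, hL⟩ := HH_lip χ₁⁻¹
  refine (abel_ex χ₂ hq₂ hodd₂ hM0 hM hL (HH_zero hq₁ (odd_inv hodd₁))
    (HH_contDiff χ₁⁻¹).continuousOn).congr' ?_
  filter_upwards [self_mem_nhdsWithin] with y hy
  exact (f_axis χ₁ χ₂ hq₁ hq₂ hodd₁ hy).symm

lemma f_axis_inf : Tendsto (fun y : ℝ => fE χ₁ χ₂ (I * y)) atTop (𝓝 0) := by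
  have h : Tendsto (fun y : ℝ => ∑' p, fT χ₁ χ₂ p (I * y)) atTop (𝓝 (∑' p : ℕ+ × ℕ+, (0:ℂ))) := by
    refine tendsto_tsum_of_dominated_convergence (bound_summable one_pos) ?_ ?_
    · intro p
      rw [tendsto_zero_iff_norm_tendsto_zero]
      have hb : Tendsto (fun y : ℝ => Real.exp (-2 * Real.pi * (y - 1)) ^ (p.1 * p.2 : ℕ)) atTop (𝓝 0) := by
        have h0 : (p.1 * p.2 : ℕ) ≠ 0 := (Nat.mul_pos p.1.pos p.2.pos).ne'
        rw [← zero_pow (M₀ := ℝ) h0]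
        refine Tendsto.pow (Real.tendsto_exp_atBot.comp ?_) _
        refine Tendsto.const_mul_atTop_of_neg (by nlinarith [Real.pi_pos]) ?_
        exact tendsto_atTop_add_const_right _ _ tendsto_id
      refine squeeze_zero (fun _ => norm_nonneg _) (fun y => ?_) hb
      exact fT_bound χ₁ χ₂ p (by simp)
    · filter_upwards [eventually_gt_atTop 1] with y hy p
      exact fT_bound χ₁ χ₂ p (by simpa using hy)
  rw [tsum_zero] at h
  refine h.congr' ?_
  filter_upwards [eventually_gt_atTop 0] with y hy
  exact (fE_eq χ₁ χ₂ (by simpa using hy)).symm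

lemma fricke (hq₁ : 1 < q₁) (hq₂ : 1 < q₂) (hodd₁ : χ₁ (-1) = -1) (hodd₂ : χ₂ (-1) = -1)
    (hχ₁ : χ₁.IsPrimitive) (hχ₂ : χ₂.IsPrimitive) {z : ℂ} (hz : 0 < z.im) :
    gaussSum' χ₁⁻¹ * fE χ₁ χ₂ z + gaussSum' χ₂⁻¹ * fE χ₂ χ₁ (-1 / ((q₁ : ℂ) * q₂ * z)) =
    gaussSum' χ₂⁻¹ * (HH χ₁⁻¹ 1 * Sl χ₂) := by
  have hq1' : (0:ℝ) < q₁ := by exact_mod_cast Nat.pos_of_ne_zero (NeZero.ne q₁)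
  have hq2' : (0:ℝ) < q₂ := by exact_mod_cast Nat.pos_of_ne_zero (NeZero.ne q₂)
  have hW : Tendsto (fun y : ℝ => ((q₁ : ℝ) * q₂ * y)⁻¹) atTop (𝓝[>] 0) := by
    refine tendsto_inv_atTop_nhdsGT_zero.comp ?_
    exact tendsto_id.const_mul_atTop (by positivity)
  have h1 := ((f_axis_inf χ₁ χ₂).const_mul (gaussSum' χ₁⁻¹)).add
    (((f_axis_zero χ₁ χ₂ hq₁ hq₂ hodd₁ hodd₂).comp hW).const_mul (gaussSum' χ₂⁻¹))
  rw [mul_zero, zero_add] at h1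
  refine tendsto_nhds_unique (tendsto_const_nhds (f := (atTop : Filter ℝ))) (h1.congr' ?_)
  filter_upwards [eventually_gt_atTop 0] with y hy
  rw [fricke_const χ₁ χ₂ hq₁ hq₂ hodd₁ hodd₂ hχ₁ hχ₂ hz (w := I * y) (by simpa using hy)]
  simp only [Function.comp_apply]
  congr 3
  have a1 : (q₁ : ℂ) ≠ 0 := NeZero.ne _
  have a2 : (q₂ : ℂ) ≠ 0 := NeZero.ne _
  have a3 : (y : ℂ) ≠ 0 := by exact_mod_cast hy.ne'
  push_cast
  field_simp
  rw [Complex.I_sq]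
end

section
variable {q : ℕ} [NeZero q] (χ : DirichletCharacter ℂ q)

lemma one_sub_eC (x : ℝ) : 1 - eC x = (2 * Real.sin (Real.pi * x) : ℝ) *
    (Real.cos (Real.pi * x - Real.pi / 2) + Real.sin (Real.pi * x - Real.pi / 2) * I) := by
  have e : eC x = (Real.cos (2 * (Real.pi * x)) : ℂ) + Real.sin (2 * (Real.pi * x)) * I := by
    rw [eC, show 2 * (Real.pi:ℂ) * I * x = ((2 * (Real.pi * x) : ℝ) : ℂ) * I by push_cast; ring,
      Complex.exp_mul_I, Complex.ofReal_cos, Complex.ofReal_sin]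
  rw [e, Real.cos_sub_pi_div_two, Real.sin_sub_pi_div_two, Real.cos_two_mul, Real.sin_two_mul]
  have := Real.sin_sq_add_cos_sq (Real.pi * x)
  have h2 : ((Real.sin (Real.pi * x) : ℂ)) ^ 2 + (Real.cos (Real.pi * x) : ℂ) ^ 2 = 1 := by
    exact_mod_cast this
  push_cast at h2 ⊢
  linear_combination (-2) * h2

lemma sin_pos_of {x : ℝ} (h0 : 0 < x) (h1 : x < 1) : 0 < Real.sin (Real.pi * x) := by
  apply Real.sin_pos_of_pos_of_lt_pi
  · have := Real.pi_pos; positivity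
  · have := Real.pi_pos; nlinarith

lemma arg_one_sub {x : ℝ} (h0 : 0 < x) (h1 : x < 1) :
    Complex.arg (1 - eC x) = Real.pi * x - Real.pi / 2 := by
  rw [one_sub_eC]
  have := Real.pi_pos
  have hs := sin_pos_of h0 h1
  rw [Complex.ofReal_cos, Complex.ofReal_sin, Complex.arg_mul_cos_add_sin_mul_I (by positivity)]
  constructor <;> nlinarith

lemma slit_one_sub {x : ℝ} (h0 : 0 < x) (h1 : x < 1) : 1 - eC x ∈ Complex.slitPlane := by
  rw [Complex.mem_slitPlane_iff_arg, arg_one_sub h0 h1]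
  have := Real.pi_pos
  refine ⟨by nlinarith, ?_⟩
  rw [one_sub_eC]
  have hs := sin_pos_of h0 h1
  rw [Complex.ofReal_cos, Complex.ofReal_sin, ← Complex.exp_mul_I]
  exact mul_ne_zero (by exact_mod_cast (by positivity)) (Complex.exp_ne_zero _)

lemma norm_one_sub (x : ℝ) : ‖1 - eC x‖ = |2 * Real.sin (Real.pi * x)| := by
  rw [one_sub_eC, norm_mul, Complex.norm_real, Real.norm_eq_abs, Complex.ofReal_cos,
    Complex.ofReal_sin, ← Complex.exp_mul_I, Complex.norm_exp_ofReal_mul_I, mul_one]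

/-- an odd character kills functions symmetric under `n ↦ q - n` -/
lemma odd_sum_zero (hq : 1 < q) (hodd : χ (-1) = -1) {u : ℕ → ℂ} (hu : ∀ n, 0 < n → n < q → u (q - n) = u n) :
    ∑ n ∈ Finset.range q, χ (n : ZMod q) * u n = 0 := by
  obtain ⟨m, rfl⟩ : ∃ m, q = m + 1 := ⟨q - 1, by omega⟩
  have h0 : χ ((0 : ℕ) : ZMod (m + 1)) = 0 := by rw [Nat.cast_zero, χ.map_zero' hq.ne']
  rw [Finset.sum_range_succ', h0, zero_mul, add_zero]
  have h1 : ∑ n ∈ Finset.range m, χ ((n + 1 : ℕ) : ZMod (m + 1)) * u (n + 1)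
      = - ∑ n ∈ Finset.range m, χ ((n + 1 : ℕ) : ZMod (m + 1)) * u (n + 1) := by
    conv_lhs => rw [← Finset.sum_range_reflect]
    rw [← Finset.sum_neg_distrib]
    refine Finset.sum_congr rfl fun n hn => ?_
    have hn := Finset.mem_range.mp hn
    have e : m - 1 - n + 1 = (m + 1) - (n + 1) := by omega
    rw [e, hu (n + 1) (by omega) (by omega)]
    have : (((m + 1) - (n + 1) : ℕ) : ZMod (m + 1)) = -1 * ((n + 1 : ℕ) : ZMod (m + 1)) := by
      rw [Nat.cast_sub (by omega)]; simp
    rw [this, map_mul, hodd]; ring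
  have h2 : (2:ℂ) * ∑ n ∈ Finset.range m, χ ((n + 1 : ℕ) : ZMod (m + 1)) * u (n + 1) = 0 := by
    linear_combination h1
  simpa using h2

lemma log_sum (hq : 1 < q) (hodd : χ (-1) = -1) :
    ∑ n ∈ Finset.range q, χ (n : ZMod q) * (-Complex.log (1 - eC ((n : ℂ) / q)))
      = Real.pi * I * HH χ 1 := by
  have hq0 : (0:ℝ) < q := by exact_mod_cast (by omega : 0 < q)
  have hqc : (q:ℂ) ≠ 0 := NeZero.ne _
  have e : ∀ n ∈ Finset.range q, χ (n : ZMod q) * (-Complex.log (1 - eC ((n : ℂ) / q)))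
      = χ (n : ZMod q) * (-((Real.log |2 * Real.sin (Real.pi * (n / q))| : ℝ) : ℂ))
        + (χ (n : ZMod q) * n) * (-(Real.pi * I) / q) + χ (n : ZMod q) * (Real.pi / 2 * I) := by
    intro n hn
    rcases Nat.eq_zero_or_pos n with rfl | hn0
    · rw [Nat.cast_zero, χ.map_zero' hq.ne']; simp
    have hn := Finset.mem_range.mp hn
    have x0 : (0:ℝ) < (n:ℝ) / q := by positivity
    have x1 : (n:ℝ) / q < 1 := by rw [div_lt_one hq0]; exact_mod_cast hn
    have c : ((n : ℂ) / q) = (((n:ℝ) / q : ℝ) : ℂ) := by push_cast; rfl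
    rw [Complex.log, c, arg_one_sub x0 x1, norm_one_sub]
    push_cast
    field_simp
    ring
  rw [Finset.sum_congr rfl e, Finset.sum_add_distrib, Finset.sum_add_distrib, ← Finset.sum_mul,
    ← Finset.sum_mul, sum_char_range hodd, odd_sum_zero χ hq hodd
      (u := fun n => (-((Real.log |2 * Real.sin (Real.pi * (n / q))| : ℝ) : ℂ))), HH_one]
  · ring
  · intro n h0 h1
    have : Real.pi * (((q - n : ℕ) : ℝ) / q) = Real.pi - Real.pi * (n / q) := by
      rw [Nat.cast_sub h1.le]; field_simp
    simp only [this, Real.sin_pi_sub]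

lemma gauss_Sl (hq : 1 < q) (hodd : χ (-1) = -1) (hχ : χ.IsPrimitive) :
    gaussSum' χ⁻¹ * Sl χ = Real.pi * I * HH χ⁻¹ 1 := by
  rw [← log_sum χ⁻¹ hq (odd_inv hodd)]
  have hq0 : (0:ℝ) < q := by exact_mod_cast (by omega : 0 < q)
  have h1 := (abel_ex χ hq hodd (P := fun t => (t : ℂ)) (M := 1) zero_le_one ?_ ?_ (by simp)
    Complex.continuous_ofReal.continuousOn).const_mul (gaussSum' χ⁻¹)
  · simp only [Complex.ofReal_one, one_mul] at h1
    have h2 : Tendsto (fun y : ℝ => ∑ n ∈ Finset.range q, χ⁻¹ (n : ZMod q) *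
        (-Complex.log (1 - (ex y : ℝ) * eC ((n : ℂ) / q)))) (𝓝[>] 0)
        (𝓝 (∑ n ∈ Finset.range q, χ⁻¹ (n : ZMod q) * (-Complex.log (1 - eC ((n : ℂ) / q))))) := by
      refine tendsto_finsetSum _ fun n hn => ?_
      rcases Nat.eq_zero_or_pos n with rfl | hn0
      · rw [Nat.cast_zero, χ⁻¹.map_zero' hq.ne']; simpa using tendsto_const_nhds
      have hn := Finset.mem_range.mp hn
      have x0 : (0:ℝ) < (n:ℝ) / q := by positivity
      have x1 : (n:ℝ) / q < 1 := by rw [div_lt_one hq0]; exact_mod_cast hn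
      have c : ((n : ℂ) / q) = (((n:ℝ) / q : ℝ) : ℂ) := by push_cast; rfl
      refine (Tendsto.neg (Tendsto.clog ?_ (c ▸ slit_one_sub x0 x1))).const_mul _
      have : Tendsto (fun y : ℝ => ((ex y : ℝ) : ℂ)) (𝓝[>] 0) (𝓝 ((1:ℝ) : ℂ)) :=
        (Complex.continuous_ofReal.tendsto 1).comp (ex_tendsto.mono_right nhdsWithin_le_nhds)
      simpa using (this.mul_const (eC ((n : ℂ) / q))).const_sub 1
    refine tendsto_nhds_unique h1 (h2.congr' ?_)
    filter_upwards [self_mem_nhdsWithin] with y hy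
    have hy := ex_mem (show 0 < y from hy)
    have hlog : ∀ n : ℕ, HasSum (fun l : ℕ => ((ex y : ℝ) * eC ((n : ℂ) / q)) ^ l / l)
        (-Complex.log (1 - (ex y : ℝ) * eC ((n : ℂ) / q))) := by
      intro n
      apply Complex.hasSum_taylorSeries_neg_log
      rw [norm_mul, norm_eC, Complex.norm_real, Real.norm_eq_abs, abs_of_pos hy.1]
      have : ((n : ℂ) / q).im = 0 := by
        rw [← Complex.ofReal_natCast, ← Complex.ofReal_natCast, ← Complex.ofReal_div, Complex.ofReal_im]
      rw [this]; simpa using hy.2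
    have hs := hasSum_sum (s := Finset.range q) fun n _ => (hlog n).mul_left (χ⁻¹ (n : ZMod q))
    rw [← hs.tsum_eq, ← tsum_mul_left]
    refine tsum_congr fun l => ?_
    have ht := gauss_twist (inv_primitive hχ) l
    rw [inv_inv] at ht
    rw [ex_nat]
    push_cast
    rw [← mul_assoc, mul_comm (gaussSum' χ⁻¹), ← ht, Finset.sum_mul]
    refine Finset.sum_congr rfl fun n _ => ?_
    rw [mul_pow, eC_natmul]; ring
  · intro t ht
    rw [Complex.norm_real, Real.norm_eq_abs, abs_of_nonneg ht.1]; exact ht.2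
  · intro t _ t' _
    rw [← Complex.ofReal_sub, Complex.norm_real, Real.norm_eq_abs, one_mul]
end

open Complex
open Filter Topology

theorem reciprocity_odd
    {q₁ q₂ : ℕ} [NeZero q₁] [NeZero q₂] (hq₁ : 1 < q₁) (hq₂ : 1 < q₂)
    (χ₁ : DirichletCharacter ℂ q₁) (χ₂ : DirichletCharacter ℂ q₂)
    (hχ₁ : χ₁.IsPrimitive) (hχ₂ : χ₂.IsPrimitive)
    (hχ₁odd : χ₁ (-1) = -1) (hχ₂odd : χ₂ (-1) = -1)
    (a b c d : ℤ) (hdet : a * d - b * (c * (q₁ * q₂ : ℕ)) = 1)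
    (z w : ℂ) (hz : 0 < z.im) (hw : 0 < w.im) :
    gaussSum' (χ₁.ringHomComp (starRingEnd ℂ)) / (Real.pi * Complex.I) *
      (fE χ₁ χ₂ (((a : ℂ) * z + (b : ℂ)) / (((c * (q₁ * q₂ : ℕ) : ℤ) : ℂ) * z + (d : ℂ))) -
        χ₁ ((d : ℤ) : ZMod q₁) * (starRingEnd ℂ) (χ₂ ((d : ℤ) : ZMod q₂)) * fE χ₁ χ₂ z) =
    -(gaussSum' (χ₂.ringHomComp (starRingEnd ℂ)) / (Real.pi * Complex.I) *
        (fE χ₂ χ₁ (((d : ℂ) * w + ((-c : ℤ) : ℂ)) / (((-b * (q₁ * q₂ : ℕ) : ℤ) : ℂ) * w + (a : ℂ))) -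
          χ₂ ((a : ℤ) : ZMod q₂) * (starRingEnd ℂ) (χ₁ ((a : ℤ) : ZMod q₁)) * fE χ₂ χ₁ w)) +
      (1 - χ₁ ((d : ℤ) : ZMod q₁) * (starRingEnd ℂ) (χ₂ ((d : ℤ) : ZMod q₂))) *
        (gaussSum' (χ₁.ringHomComp (starRingEnd ℂ)) * gaussSum' (χ₂.ringHomComp (starRingEnd ℂ)) /
          (Real.pi * Complex.I) ^ 2) *
        (DirichletCharacter.LFunction χ₁ 1) * (DirichletCharacter.LFunction χ₂ 1) := by
  rw [conj_comp_eq_inv, conj_comp_eq_inv]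
  simp only [conj_apply_eq_inv]
  obtain ⟨e1, e2⟩ := det_mod hdet
  have hψ : χ₂ (a : ZMod q₂) * χ₁⁻¹ (a : ZMod q₁) = χ₁ (d : ZMod q₁) * χ₂⁻¹ (d : ZMod q₂) := by
    rw [char_inv_eq χ₂ e2, char_inv_eq χ₁ (by rw [mul_comm]; exact e1), mul_comm]
  have hdet' : d * a - (-c) * ((-b) * (q₂ * q₁ : ℕ)) = 1 := by
    rw [← hdet]; push_cast; ring
  have hW := W_im (q₁ := q₁) (q₂ := q₂) hz
  have hγ := moeb_im hdet hz
  have hg := f_mod_const χ₂ χ₁ hq₂ hχ₂odd hχ₁odd hχ₁ d (-c) (-b) a hdet' hw hW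
  rw [mul_comm q₂ q₁] at hg
  rw [hg, hψ]
  have hF1 := fricke χ₁ χ₂ hq₁ hq₂ hχ₁odd hχ₂odd hχ₁ hχ₂ hz
  have hF2 := fricke χ₁ χ₂ hq₁ hq₂ hχ₁odd hχ₂odd hχ₁ hχ₂ hγ
  have hq1' : (q₁ : ℂ) ≠ 0 := NeZero.ne _
  have hq2' : (q₂ : ℂ) ≠ 0 := NeZero.ne _
  have hz0 : z ≠ 0 := by rintro rfl; simp at hz
  have hden : ((c * (q₁ * q₂ : ℕ) : ℤ) : ℂ) * z + d ≠ 0 := by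
    intro h0
    rw [h0, div_zero] at hγ
    simp at hγ
  have hnum : (a : ℂ) * z + b ≠ 0 := by
    intro h0
    rw [h0, zero_div] at hγ
    simp at hγ
  have hcomm : ((d : ℂ) * (-1 / ((q₁ : ℂ) * q₂ * z)) + ((-c : ℤ) : ℂ)) /
      (((-b * (q₁ * q₂ : ℕ) : ℤ) : ℂ) * (-1 / ((q₁ : ℂ) * q₂ * z)) + (a : ℂ)) =
      -1 / ((q₁ : ℂ) * q₂ * (((a : ℂ) * z + b) / (((c * (q₁ * q₂ : ℕ) : ℤ) : ℂ) * z + d))) := by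
    have e3 : ((-b * (q₁ * q₂ : ℕ) : ℤ) : ℂ) * (-1 / ((q₁ : ℂ) * q₂ * z)) + (a : ℂ)
        = (a * z + b) / z := by
      push_cast; field_simp; ring
    have e4 : (d : ℂ) * (-1 / ((q₁ : ℂ) * q₂ * z)) + ((-c : ℤ) : ℂ)
        = - (((c * (q₁ * q₂ : ℕ) : ℤ) : ℂ) * z + d) / ((q₁ : ℂ) * q₂ * z) := by
      push_cast; field_simp; ring
    rw [e3, e4]
    field_simp
  rw [hcomm]
  have hL1 := gauss_Sl χ₁ hq₁ hχ₁odd hχ₁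
  rw [Sl_eq_L χ₁ hq₁ hχ₁odd] at hL1
  rw [Sl_eq_L χ₂ hq₂ hχ₂odd] at hF1 hF2
  have hpi : (Real.pi * I : ℂ) ≠ 0 := mul_ne_zero (by exact_mod_cast Real.pi_ne_zero) Complex.I_ne_zero
  set P := (Real.pi * I : ℂ)
  set ψ := χ₁ (d : ZMod q₁) * χ₂⁻¹ (d : ZMod q₂)
  have hC : gaussSum' χ₁⁻¹ * gaussSum' χ₂⁻¹ / P ^ 2 * DirichletCharacter.LFunction χ₁ 1 *
      DirichletCharacter.LFunction χ₂ 1 =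
      gaussSum' χ₂⁻¹ * (HH χ₁⁻¹ 1 * DirichletCharacter.LFunction χ₂ 1) / P := by
    rw [show gaussSum' χ₁⁻¹ * gaussSum' χ₂⁻¹ / P ^ 2 * DirichletCharacter.LFunction χ₁ 1 *
      DirichletCharacter.LFunction χ₂ 1 = (gaussSum' χ₁⁻¹ * DirichletCharacter.LFunction χ₁ 1) *
      (gaussSum' χ₂⁻¹ * DirichletCharacter.LFunction χ₂ 1) / P ^ 2 by ring, hL1]
    field_simp
  linear_combination (1 / P) * hF2 - (ψ / P) * hF1 - (1 - ψ) * hC
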